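/- arXiv:math/0008135 — 4 statements merged into one kernel-verified Lean document; each statement's English description precedes it below -/
import Mathlib

section
/- Let X and Y be real normed vector spaces with dim X ≥ dim Y = 2, Y strictly convex, and let ρ > 0. If x, y ∈ X and ||x−y||/ρ is rational, then there exists a finite set S ⊆ X containing x and y such that every injective map f : S → Y preserving the distance ρ satisfies ||f(x) − f(y)|| = ||x − y||. -/
section helpers

variable {X Y : Type*}
    [NormedAddCommGroup X] [NormedSpace ℝ X] [NormedAddCommGroup Y] [NormedSpace ℝ Y]

lemma dbq_core [StrictConvexSpace ℝ Y] {R α β : ℝ} {a p s : Y} (hp : p ≠ 0)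
    (h1 : ‖p + a‖ = R) (h2 : ‖p - a‖ = R) (h3 : ‖s + a‖ = R) (h4 : ‖s - a‖ = R)
    (hs : s = α • a + β • p) (hα : 0 ≤ α) (hβ : |β| < 1) : False := by
  obtain ⟨hb1, hb2⟩ := abs_lt.1 hβ
  have h5 : ‖-p - a‖ = R := by rw [← h1, ← norm_neg]; congr 1; module
  have hne : p - a ≠ -p - a := by
    intro h
    have : (2 : ℝ) • p = 0 := by
      have h' : p = -p := sub_left_injective h
      rw [two_smul]; nth_rewrite 1 [h']; simp
    simp at this
    exact hp this
  have h6 : ‖((1 + β) / 2) • (p - a) + ((1 - β) / 2) • (-p - a)‖ < R :=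
    norm_combo_lt_of_ne h2.le h5.le hne (by linarith) (by linarith) (by ring)
  have e1 : ((1 + β) / 2) • (p - a) + ((1 - β) / 2) • (-p - a) = β • p - a := by module
  rw [e1] at h6
  have e2 : (α + 2) • (s - a) = (2 : ℝ) • (β • p - a) + α • (s + a) := by
    rw [hs]; module
  have h7 : ‖(α + 2) • (s - a)‖ ≤ ‖(2 : ℝ) • (β • p - a)‖ + ‖α • (s + a)‖ := by
    rw [e2]; exact norm_add_le _ _
  rw [norm_smul, norm_smul, norm_smul, h3, h4, Real.norm_of_nonneg (by linarith),
    Real.norm_of_nonneg (by norm_num), Real.norm_of_nonneg hα] at h7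
  nlinarith

lemma dbq_core' [StrictConvexSpace ℝ Y] {R α β : ℝ} {a p s : Y} (hp : p ≠ 0)
    (h1 : ‖p + a‖ = R) (h2 : ‖p - a‖ = R) (h3 : ‖s + a‖ = R) (h4 : ‖s - a‖ = R)
    (hs : s = α • a + β • p) (hβ : |β| < 1) : False := by
  rcases le_total 0 α with h | h
  · exact dbq_core hp h1 h2 h3 h4 hs h hβ
  · refine dbq_core (a := -a) (α := -α) (s := s) (R := R) hp (by rwa [← sub_eq_add_neg]) (by rwa [sub_neg_eq_add])
      (by rwa [← sub_eq_add_neg]) (by rwa [sub_neg_eq_add]) (by rw [hs]; module) (by linarith) hβ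

lemma dbq_one [StrictConvexSpace ℝ Y] {R α : ℝ} {a p s : Y} (ha : a ≠ 0)
    (h1 : ‖p + a‖ = R) (h2 : ‖p - a‖ = R) (h3 : ‖s + a‖ = R)
    (hs : s = α • a + p) (hα : 0 < α) : False := by
  have hne : p - a ≠ s + a := by
    intro h
    have : (α + 2) • a = 0 := by
      have : (α + 2) • a = (s + a) - (p - a) := by rw [hs]; module
      rw [this, h]; simp
    rcases smul_eq_zero.1 this with h | h
    · linarith
    · exact ha h
  have h6 : ‖(α / (α + 2)) • (p - a) + (2 / (α + 2)) • (s + a)‖ < R :=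
    norm_combo_lt_of_ne h2.le h3.le hne (by positivity) (by positivity) (by field_simp)
  have e : (α / (α + 2)) • (p - a) + (2 / (α + 2)) • (s + a) = p + a := by
    rw [hs]
    have : α + 2 ≠ 0 := by positivity
    match_scalars <;> field_simp <;> ring
  rw [e] at h6
  linarith

lemma dbq_one' [StrictConvexSpace ℝ Y] {R α : ℝ} {a p s : Y} (ha : a ≠ 0)
    (h1 : ‖p + a‖ = R) (h2 : ‖p - a‖ = R) (h3 : ‖s + a‖ = R) (h4 : ‖s - a‖ = R)
    (hs : s = α • a + p) : s = p := by
  rcases lt_trichotomy α 0 with h | h | h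
  · exfalso
    exact dbq_one (a := -a) (α := -α) (p := p) (s := s) (R := R) (by simpa using ha)
      (by rwa [← sub_eq_add_neg]) (by rwa [sub_neg_eq_add])
      (by rwa [← sub_eq_add_neg]) (by rw [hs]; module) (by linarith)
  · simp [hs, h]
  · exact (dbq_one ha h1 h2 h3 hs h).elim

/-- Centered version of the two-circle intersection lemma. -/
lemma dbq_centered [StrictConvexSpace ℝ Y] (hY : Module.finrank ℝ Y = 2) {R : ℝ} {a p s : Y}
    (ha : a ≠ 0) (haR : ‖a‖ < R)
    (h1 : ‖p + a‖ = R) (h2 : ‖p - a‖ = R) (h3 : ‖s + a‖ = R) (h4 : ‖s - a‖ = R) :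
    s = p ∨ s = -p := by
  have hp : p ≠ 0 := by rintro rfl; simp at h1; linarith
  have hs0 : s ≠ 0 := by rintro rfl; simp at h3; linarith
  have hli : LinearIndependent ℝ ![a, p] := by
    rw [LinearIndependent.pair_iff' ha]
    intro t ht
    have e1 : p + a = (t + 1) • a := by rw [← ht]; module
    have e2 : p - a = (t - 1) • a := by rw [← ht]; module
    have e3 : |t + 1| = |t - 1| := by
      have := h1.trans h2.symm
      rw [e1, e2, norm_smul, norm_smul] at this
      exact mul_right_cancel₀ (norm_ne_zero_iff.2 ha) this
    have : t = 0 := by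
      rcases abs_eq_abs.1 e3 with h | h <;> linarith
    apply hp
    rw [← ht, this, zero_smul]
  have hspan : Submodule.span ℝ (Set.range ![a, p]) = ⊤ :=
    hli.span_eq_top_of_card_eq_finrank (by simp [hY])
  have hmem : s ∈ Submodule.span ℝ (Set.range ![a, p]) := by rw [hspan]; trivial
  simp only [Matrix.range_cons, Matrix.range_empty, Set.union_empty, Set.singleton_union] at hmem
  obtain ⟨α, β, hs⟩ := Submodule.mem_span_pair.1 hmem
  rcases lt_trichotomy |β| 1 with h | h | h
  · exact (dbq_core' hp h1 h2 h3 h4 hs.symm h).elim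
  · rcases (abs_eq zero_le_one).1 h with h | h
    · left
      exact dbq_one' ha h1 h2 h3 h4 (α := α) (by rw [← hs, h, one_smul])
    · right
      refine dbq_one' ha (R := R) (α := α) ?_ ?_ h3 h4 (by rw [← hs, h]; module)
      · rw [← h2, ← norm_neg]; congr 1; module
      · rw [← h1, ← norm_neg]; congr 1; module
  · exfalso
    have hβ : β ≠ 0 := by rintro rfl; simp at h; linarith
    refine dbq_core' hs0 h3 h4 h1 h2 (α := -α / β) (β := β⁻¹) ?_ ?_
    · rw [← hs]; match_scalars <;> field_simp; ring
    · rw [abs_inv]; exact inv_lt_one_of_one_lt₀ h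

/-- Rhombus lemma. -/
lemma dbq_rhombus [StrictConvexSpace ℝ Y] (hY : Module.finrank ℝ Y = 2) {ρ : ℝ} (hρ : 0 < ρ)
    {A B P Q : Y} (hAB : ‖A - B‖ = ρ) (h1 : ‖P - A‖ = ρ) (h2 : ‖P - B‖ = ρ)
    (h3 : ‖Q - A‖ = ρ) (h4 : ‖Q - B‖ = ρ) (hne : Q ≠ P) : Q = A + B - P := by
  have hnorm : ‖(1 / 2 : ℝ) • (A - B)‖ = ρ / 2 := by
    rw [norm_smul, hAB]; norm_num; ring
  have key := dbq_centered hY (R := ρ) (a := (1 / 2 : ℝ) • (A - B))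
    (p := P - (1 / 2 : ℝ) • (A + B)) (s := Q - (1 / 2 : ℝ) • (A + B))
    (by rw [← norm_ne_zero_iff, hnorm]; positivity) (by rw [hnorm]; linarith)
    (by rw [← h2]; congr 1; module) (by rw [← h1]; congr 1; module)
    (by rw [← h4]; congr 1; module) (by rw [← h3]; congr 1; module)
  rcases key with h | h
  · exact (hne (sub_left_injective h)).elim
  · have : Q = (Q - (1 / 2 : ℝ) • (A + B)) + (1 / 2 : ℝ) • (A + B) := by module
    rw [this, h]; module

lemma dbq_isosceles (hX : 2 ≤ Module.rank ℝ X) {r : ℝ} (hr : 0 < r) (w : X) (hw0 : w ≠ 0)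
    (hw : ‖w‖ ≤ 2 * r) : ∃ v : X, ‖v‖ = r ∧ ‖w - v‖ = r := by
  have hX' : 1 < Module.rank ℝ X := lt_of_lt_of_le (by norm_num) hX
  have hconn := isPreconnected_sphere hX' (0 : X) r
  have hn : 0 < ‖w‖ := norm_pos_iff.2 hw0
  have hcn : ‖(r / ‖w‖) • w‖ = r := by
    rw [norm_smul, Real.norm_of_nonneg (by positivity)]; field_simp
  have m1 : (r / ‖w‖) • w ∈ Metric.sphere (0 : X) r := by simpa using hcn
  have m2 : -((r / ‖w‖) • w) ∈ Metric.sphere (0 : X) r := by simpa using hcn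
  have hiv := hconn.intermediate_value m1 m2 (f := fun v => ‖w - v‖) (by fun_prop)
  have v1 : ‖w - (r / ‖w‖) • w‖ ≤ r := by
    have : w - (r / ‖w‖) • w = (1 - r / ‖w‖) • w := by module
    have e0 : |1 - r / ‖w‖| * ‖w‖ = |(1 - r / ‖w‖) * ‖w‖| := by
      rw [abs_mul, abs_of_pos hn]
    rw [this, norm_smul, Real.norm_eq_abs, e0]
    have : (1 - r / ‖w‖) * ‖w‖ = ‖w‖ - r := by field_simp
    rw [this, abs_le]
    constructor <;> linarith
  have v2 : r ≤ ‖w - -((r / ‖w‖) • w)‖ := by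
    have : w - -((r / ‖w‖) • w) = (1 + r / ‖w‖) • w := by module
    rw [this, norm_smul, Real.norm_of_nonneg (by positivity)]
    have : (1 + r / ‖w‖) * ‖w‖ = ‖w‖ + r := by field_simp
    rw [this]; linarith
  obtain ⟨v, hv, hv'⟩ := hiv ⟨v1, v2⟩
  exact ⟨v, by simpa using hv, hv'⟩

lemma dbq_line [StrictConvexSpace ℝ Y] (hX : 2 ≤ Module.rank ℝ X) (hY : Module.finrank ℝ Y = 2)
    {ρ : ℝ} (hρ : 0 < ρ) (x u : X) (hu : ‖u‖ = ρ) (N : ℕ) :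
    ∃ S : Finset X, (∀ k : ℕ, k ≤ N → x + (k : ℝ) • u ∈ S) ∧
      (x + u ∈ S) ∧
      ∀ f : X → Y, Set.InjOn f ↑S →
        (∀ a ∈ S, ∀ b ∈ S, ‖a - b‖ = ρ → ‖f a - f b‖ = ρ) →
        ∀ k : ℕ, k ≤ N → f (x + (k : ℝ) • u) = f x + (k : ℝ) • (f (x + u) - f x) := by
  classical
  have hu0 : u ≠ 0 := by rw [← norm_ne_zero_iff, hu]; positivity
  obtain ⟨v, hv, huv⟩ := dbq_isosceles hX hρ u hu0 (by linarith)
  have hv0 : v ≠ 0 := by rw [← norm_ne_zero_iff, hv]; positivity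
  have hvu : ‖v - u‖ = ρ := by rw [norm_sub_rev, huv]
  let g : ℕ × ℕ → X := fun ij => x + (ij.1 : ℝ) • u + (ij.2 : ℝ) • v
  let S := (Finset.range (N + 2) ×ˢ Finset.range 2).image g
  have m0 : ∀ k : ℕ, k ≤ N + 1 → x + (k : ℝ) • u ∈ S := by
    intro k hk
    refine Finset.mem_image.2 ⟨(k, 0), ?_, by simp [g]⟩
    simp; omega
  have m1 : ∀ k : ℕ, k ≤ N + 1 → x + (k : ℝ) • u + v ∈ S := by
    intro k hk
    refine Finset.mem_image.2 ⟨(k, 1), ?_, by simp [g]⟩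
    simp; omega
  refine ⟨S, fun k hk => m0 k (by omega), by simpa using m0 1 (by omega), ?_⟩
  intro f hinj hf
  have rh : ∀ p ∈ S, ∀ q ∈ S, ∀ r ∈ S, ∀ s ∈ S, ‖q - r‖ = ρ → ‖p - q‖ = ρ → ‖p - r‖ = ρ →
      ‖s - q‖ = ρ → ‖s - r‖ = ρ → s ≠ p → f s = f q + f r - f p := by
    intro p hp q hq r hr s hs e1 e2 e3 e4 e5 hne
    exact dbq_rhombus hY hρ (hf _ hq _ hr e1) (hf _ hp _ hq e2) (hf _ hp _ hr e3)
      (hf _ hs _ hq e4) (hf _ hs _ hr e5) (fun h => hne (hinj hs hp h))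
  have step : ∀ k : ℕ, k + 2 ≤ N →
      f (x + ((k + 2 : ℕ) : ℝ) • u) =
        (2 : ℝ) • f (x + ((k + 1 : ℕ) : ℝ) • u) - f (x + (k : ℝ) • u) := by
    intro k hk
    have r1 := rh _ (m0 k (by omega)) _ (m0 (k + 1) (by omega)) _ (m1 k (by omega))
      _ (m1 (k + 1) (by omega))
      (by rw [← huv]; congr 1; push_cast; module)
      (by rw [← hu, ← norm_neg u]; congr 1; push_cast; module)
      (by rw [← hv, ← norm_neg v]; congr 1; module)
      (by rw [← hv]; congr 1; module)
      (by rw [← hu]; congr 1; push_cast; module)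
      (by
        intro h
        have e : u - -v = 0 := by
          rw [← sub_eq_zero] at h; rw [← h]; push_cast; module
        have e' : u = -v := sub_eq_zero.1 e
        have : ‖u - v‖ = 2 * ρ := by
          rw [e', ← hv]
          have : -v - v = (-2 : ℝ) • v := by module
          rw [this, norm_smul]; norm_num
        linarith)
    have r2 := rh _ (m1 k (by omega)) _ (m0 (k + 1) (by omega)) _ (m1 (k + 1) (by omega))
      _ (m0 (k + 2) (by omega))
      (by rw [← hv, ← norm_neg v]; congr 1; module)
      (by rw [← hvu]; congr 1; push_cast; module)
      (by rw [← hu, ← norm_neg u]; congr 1; push_cast; module)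
      (by rw [← hu]; congr 1; push_cast; module)
      (by rw [← huv]; congr 1; push_cast; module)
      (by
        intro h
        have e : (2 : ℝ) • u = v := by
          rw [← sub_eq_zero] at h ⊢; rw [← h]; push_cast; module
        have : ‖(2 : ℝ) • u‖ = 2 * ρ := by rw [norm_smul, hu]; norm_num
        rw [e] at this
        linarith)
    rw [r2, r1]; module
  intro k
  induction k using Nat.strong_induction_on with
  | _ k ih =>
    intro hk
    match k, ih, hk with
    | 0, _, _ => simp
    | 1, _, _ => simp
    | k + 2, ih, hk =>
      rw [step k hk, ih (k + 1) (by omega) (by omega), ih k (by omega) (by omega)]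
      push_cast
      module

end helpers

/-- Item 1 of the Theorem: if `‖x - y‖ / ρ` is rational then there is a finite set `S`
containing `x` and `y` such that every injective map `f : S → Y` preserving the
distance `ρ` preserves the distance between `x` and `y`. -/
theorem discrete_beckman_quarles_rational {X Y : Type*}
    [NormedAddCommGroup X] [NormedSpace ℝ X] [NormedAddCommGroup Y] [NormedSpace ℝ Y]
    (hX : 2 ≤ Module.rank ℝ X) (hY : Module.finrank ℝ Y = 2)
    (hsc : ∀ a b : Y, a ≠ 0 → b ≠ 0 → ‖a + b‖ = ‖a‖ + ‖b‖ → ∃ γ : ℝ, 0 < γ ∧ a = γ • b)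
    (ρ : ℝ) (hρ : 0 < ρ) (x y : X) (hq : ∃ q : ℚ, ‖x - y‖ / ρ = (q : ℝ)) :
    ∃ S : Finset X, x ∈ S ∧ y ∈ S ∧
      ∀ f : X → Y, Set.InjOn f ↑S →
        (∀ a ∈ S, ∀ b ∈ S, ‖a - b‖ = ρ → ‖f a - f b‖ = ρ) →
        ‖f x - f y‖ = ‖x - y‖ := by
  classical
  haveI : StrictConvexSpace ℝ Y := by
    refine StrictConvexSpace.of_norm_add fun a b ha hb hab => ?_
    obtain ⟨γ, hγ, h⟩ := hsc a b (by rintro rfl; simp at ha) (by rintro rfl; simp at hb)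
      (by rw [hab, ha, hb]; norm_num)
    rw [h]
    exact SameRay.sameRay_pos_smul_left b hγ
  by_cases hxy : x = y
  · subst hxy
    exact ⟨{x}, by simp, by simp, by simp⟩
  obtain ⟨q, hq⟩ := hq
  have hd : 0 < ‖x - y‖ := norm_pos_iff.2 (sub_ne_zero.2 hxy)
  have hqpos : 0 < q := by
    have : (0 : ℝ) < q := by rw [← hq]; positivity
    exact_mod_cast this
  obtain ⟨m, n, hm, hn, hdist⟩ : ∃ m n : ℕ, 0 < m ∧ 0 < n ∧ (n : ℝ) * ‖x - y‖ = m * ρ := by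
    refine ⟨q.num.natAbs, q.den, ?_, q.den_pos, ?_⟩
    · have := Rat.num_pos.2 hqpos; omega
    · have h1 : ((q.num.natAbs : ℕ) : ℝ) = (q.num : ℝ) := by
        have : ((q.num.natAbs : ℕ) : ℤ) = q.num :=
          Int.natAbs_of_nonneg (Rat.num_pos.2 hqpos).le
        rw [← this, Int.natAbs_natCast, Int.cast_natCast]
      have h2 : (q : ℝ) = q.num / q.den := Rat.cast_def q
      have h3 : (q.den : ℝ) ≠ 0 := by exact_mod_cast q.den_ne_zero
      rw [h1]
      rw [h2] at hq
      field_simp at hq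
      linarith
  have hm' : (0 : ℝ) < m := by exact_mod_cast hm
  have hn' : (0 : ℝ) < n := by exact_mod_cast hn
  have hn1 : (1 : ℝ) ≤ n := by exact_mod_cast hn
  have hyx : ‖y - x‖ = ‖x - y‖ := norm_sub_rev _ _
  obtain ⟨v, hv, hwv⟩ := dbq_isosceles hX (r := m * ρ) (by positivity) (y - x)
    (sub_ne_zero.2 (Ne.symm hxy)) (by rw [hyx]; nlinarith)
  obtain ⟨z, hz⟩ : ∃ z, z = x + v := ⟨_, rfl⟩
  obtain ⟨u1, hu1⟩ : ∃ u : X, u = (m : ℝ)⁻¹ • (-v) := ⟨_, rfl⟩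
  obtain ⟨u2, hu2⟩ : ∃ u : X, u = (m : ℝ)⁻¹ • (y - x - v) := ⟨_, rfl⟩
  obtain ⟨u3, hu3⟩ : ∃ u : X, u = ((m : ℝ)⁻¹ * n) • (y - x) := ⟨_, rfl⟩
  have nu1 : ‖u1‖ = ρ := by
    rw [hu1, norm_smul, norm_neg, hv, Real.norm_of_nonneg (by positivity)]; field_simp
  have nu2 : ‖u2‖ = ρ := by
    rw [hu2, norm_smul, hwv, Real.norm_of_nonneg (by positivity)]; field_simp
  have nu3 : ‖u3‖ = ρ := by
    rw [hu3, norm_smul, hyx, Real.norm_of_nonneg (by positivity), mul_assoc, hdist]; field_simp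
  have hmn : m ≤ n * m := Nat.le_mul_of_pos_left m hn
  have ex : z + (m : ℝ) • u1 = x := by
    rw [hz, hu1]; match_scalars <;> field_simp; ring
  have ey : z + (m : ℝ) • u2 = y := by
    rw [hz, hu2]; match_scalars <;> field_simp <;> ring
  have exy : z + ((n * m : ℕ) : ℝ) • u1 + (m : ℝ) • u3 = z + ((n * m : ℕ) : ℝ) • u2 := by
    rw [hu1, hu2, hu3]; push_cast; match_scalars <;> field_simp <;> ring
  obtain ⟨x1, hx1⟩ : ∃ x1, x1 = z + ((n * m : ℕ) : ℝ) • u1 := ⟨_, rfl⟩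
  obtain ⟨S1, hS1, _, hf1⟩ := dbq_line hX hY hρ z u1 nu1 (n * m)
  obtain ⟨S2, hS2, _, hf2⟩ := dbq_line hX hY hρ z u2 nu2 (n * m)
  obtain ⟨S3, hS3, hS3', hf3⟩ := dbq_line hX hY hρ x1 u3 nu3 m
  have mx : x ∈ S1 := by rw [← ex]; exact hS1 m hmn
  have my : y ∈ S2 := by rw [← ey]; exact hS2 m hmn
  refine ⟨S1 ∪ (S2 ∪ S3), by simp [mx], by simp [my], ?_⟩
  intro f hinj hf
  have i1 : S1 ⊆ S1 ∪ (S2 ∪ S3) := Finset.subset_union_left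
  have i2 : S2 ⊆ S1 ∪ (S2 ∪ S3) :=
    Finset.subset_union_left.trans Finset.subset_union_right
  have i3 : S3 ⊆ S1 ∪ (S2 ∪ S3) :=
    Finset.subset_union_right.trans Finset.subset_union_right
  have g1 := hf1 f (hinj.mono (by exact_mod_cast i1))
    (fun a ha b hb => hf a (i1 ha) b (i1 hb))
  have g2 := hf2 f (hinj.mono (by exact_mod_cast i2))
    (fun a ha b hb => hf a (i2 ha) b (i2 hb))
  have g3 := hf3 f (hinj.mono (by exact_mod_cast i3))
    (fun a ha b hb => hf a (i3 ha) b (i3 hb))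
  have fx := g1 m hmn
  have fy := g2 m hmn
  have fx1 := g1 (n * m) le_rfl
  have fy1 := g2 (n * m) le_rfl
  have fxy := g3 m le_rfl
  have hx1S : x1 ∈ S3 := by simpa using hS3 0 (Nat.zero_le _)
  have hd3 : ‖f (x1 + u3) - f x1‖ = ρ :=
    hf _ (i3 hS3') _ (i3 hx1S) (by rw [← nu3]; congr 1; module)
  rw [ex] at fx
  rw [ey] at fy
  rw [← hx1] at fx1 exy
  rw [exy, fy1, fx1] at fxy
  have e : (n : ℝ) • (f y - f x) = (m : ℝ) • (f (x1 + u3) - f x1) := by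
    rw [fx, fy, fx1, ← sub_eq_zero]
    rw [← sub_eq_zero] at fxy
    rw [← fxy]
    push_cast
    module
  have e' := congrArg norm e
  rw [norm_smul, norm_smul, hd3, Real.norm_of_nonneg hn'.le, Real.norm_of_nonneg hm'.le,
    ← hdist] at e'
  rw [norm_sub_rev]
  exact mul_left_cancel₀ hn'.ne' e'
end

section
/- Let X = ℝⁿ (2 ≤ n < ∞) with the euclidean norm, Y a strictly convex two-dimensional real normed space, and ρ > 0. If x, y ∈ X and |x−y|/ρ is rational, then there exists a finite set S ⊆ ℝⁿ containing x and y such that every (not necessarily injective) map f : S → Y preserving the distance ρ satisfies ||f(x) − f(y)|| = |x − y|. -/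
namespace DBQ

section Plane
variable {Y : Type*} [NormedAddCommGroup Y] [NormedSpace ℝ Y]

lemma strict_of (hsc : ∀ a b : Y, a ≠ 0 → b ≠ 0 → ‖a + b‖ = ‖a‖ + ‖b‖ →
    ∃ γ : ℝ, 0 < γ ∧ a = γ • b) : StrictConvexSpace ℝ Y := by
  apply StrictConvexSpace.of_norm_add
  intro x y hx hy hxy
  have hx0 : x ≠ 0 := by rintro rfl; simp at hx
  have hy0 : y ≠ 0 := by rintro rfl; simp at hy
  obtain ⟨γ, hγ, rfl⟩ := hsc x y hx0 hy0 (by rw [hxy, hx, hy]; norm_num)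
  exact SameRay.sameRay_pos_smul_left y hγ

variable [StrictConvexSpace ℝ Y]

/-- strict convexity of the norm along a line -/
lemma line_lt {u c : Y} (hu : u ≠ 0) {ρ s t r : ℝ} (hst : s < t) (htr : t < r)
    (h1 : ‖s • u + c‖ ≤ ρ) (h2 : ‖r • u + c‖ ≤ ρ) : ‖t • u + c‖ < ρ := by
  have hsr : 0 < r - s := by linarith
  have hne : s • u + c ≠ r • u + c := by
    intro h
    have h3 := smul_left_injective ℝ hu (add_right_cancel h)
    linarith
  have := norm_combo_lt_of_ne h1 h2 hne (a := (r - t) / (r - s)) (b := (t - s) / (r - s))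
    (div_pos (by linarith) hsr) (div_pos (by linarith) hsr) (by field_simp; ring)
  convert this using 2
  have e : t = (r - t) / (r - s) * s + (t - s) / (r - s) * r := by field_simp; ring
  have e' : (1 : ℝ) = (r - t) / (r - s) + (t - s) / (r - s) := by field_simp; ring
  have e2 : t • u + c = ((r - t) / (r - s) * s + (t - s) / (r - s) * r) • u
      + ((r - t) / (r - s) + (t - s) / (r - s)) • c := by
    rw [← e, ← e', one_smul]
  rw [e2]
  module

lemma core {u v w : Y} {ρ α β : ℝ} (hρ : 0 < ρ) (hu : ‖u‖ = ρ) (hv : ‖v‖ = ρ)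
    (hvu : ‖v - u‖ = ρ) (hw : ‖w‖ = ρ) (hwu : ‖w - u‖ = ρ) (h : w = α • u + β • v)
    (hβ : 0 < β) (hβ1 : β ≤ 1) : w = v := by
  have hu0 : u ≠ 0 := by rintro rfl; simp at hu; linarith
  have n1 : ‖(-1 : ℝ) • u + β • v‖ ≤ ρ := by
    have e : (-1 : ℝ) • u + β • v = β • (v - u) + (1 - β) • (-u) := by module
    rw [e]
    refine (norm_add_le _ _).trans ?_
    rw [norm_smul, norm_smul, norm_neg, hvu, hu, Real.norm_of_nonneg hβ.le,
      Real.norm_of_nonneg (by linarith)]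
    linarith
  have n2 : ‖(1 - β) • u + β • v‖ ≤ ρ := by
    refine (norm_add_le _ _).trans ?_
    rw [norm_smul, norm_smul, hv, hu, Real.norm_of_nonneg hβ.le,
      Real.norm_of_nonneg (by linarith)]
    linarith
  have n3 : ‖α • u + β • v‖ = ρ := by rw [← h, hw]
  have n4 : ‖(α - 1) • u + β • v‖ = ρ := by
    rw [← hwu, h]; congr 1; module
  rcases lt_trichotomy α (1 - β) with ha | ha | ha
  · have := line_lt hu0 (by linarith) ha n4.le n2
    linarith
  · rcases hβ1.lt_or_eq with hb | hb
    · have := line_lt hu0 (t := α - 1) (by linarith) (by linarith) n1 n3.le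
      linarith
    · subst hb
      rw [h, ha]; simp
  · have := line_lt hu0 (t := α - 1) (by linarith) (by linarith) n1 n3.le
    linarith

lemma core' {u v w : Y} {ρ α β : ℝ} (hρ : 0 < ρ) (hu : ‖u‖ = ρ) (hv : ‖v‖ = ρ)
    (hvu : ‖v - u‖ = ρ) (hw : ‖w‖ = ρ) (hwu : ‖w - u‖ = ρ) (h : w = α • u + β • v)
    (hβ : 0 < β) : w = v := by
  rcases le_total β 1 with hb | hb
  · exact core hρ hu hv hvu hw hwu h hβ hb
  · refine (core (α := -(α / β)) (β := β⁻¹) hρ hu hw hwu hv hvu ?_ (by positivity)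
      (inv_le_one_of_one_le₀ hb)).symm
    rw [h, smul_add, smul_smul, smul_smul, inv_mul_cancel₀ hβ.ne']
    rw [div_eq_inv_mul]
    module

lemma not_par {u v : Y} {ρ : ℝ} (hρ : 0 < ρ) (hu : ‖u‖ = ρ) (hv : ‖v‖ = ρ)
    (hvu : ‖v - u‖ = ρ) (a : ℝ) : a • u ≠ v := by
  rintro rfl
  have e : a • u - u = (a - 1) • u := by module
  rw [e, norm_smul, hu, Real.norm_eq_abs] at hvu
  rw [norm_smul, hu, Real.norm_eq_abs] at hv
  have h1 : |a| = 1 := by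
    apply mul_right_cancel₀ hρ.ne'; linarith
  have h2 : |a - 1| = 1 := by
    apply mul_right_cancel₀ hρ.ne'; linarith
  rcases (abs_eq (by norm_num)).1 h1 with h | h <;> rw [h] at h2 <;> norm_num at h2

lemma two_pts (hY : Module.finrank ℝ Y = 2) {u v w : Y} {ρ : ℝ} (hρ : 0 < ρ) (hu : ‖u‖ = ρ)
    (hv : ‖v‖ = ρ) (hvu : ‖v - u‖ = ρ) (hw : ‖w‖ = ρ) (hwu : ‖w - u‖ = ρ) :
    w = v ∨ w = u - v := by
  have hu0 : u ≠ 0 := by rintro rfl; simp at hu; linarith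
  have li : LinearIndependent ℝ ![u, v] :=
    (LinearIndependent.pair_iff' hu0).2 (not_par hρ hu hv hvu)
  have : FiniteDimensional ℝ Y := Module.finite_of_finrank_pos (by omega)
  have sp := li.span_eq_top_of_card_eq_finrank' (by simp [hY])
  have hm : w ∈ Submodule.span ℝ ({u, v} : Set Y) := by
    have : Set.range ![u, v] = {u, v} := by simp [Set.pair_comm]
    rw [← this, sp]; trivial
  obtain ⟨α, β, h⟩ := Submodule.mem_span_pair.1 hm
  rcases lt_trichotomy β 0 with hb | hb | hb
  · right
    have := core' (w := u - w) (α := 1 - α) (β := -β) hρ hu hv hvu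
      (by rw [← hwu, norm_sub_rev]) (by rw [← hw, ← norm_neg]; congr 1; abel)
      (by rw [← h]; module) (by linarith)
    rw [← this]; abel
  · exact absurd (by rw [← h, hb]; simp) (not_par hρ hu hw hwu α)
  · left
    exact core' hρ hu hv hvu hw hwu h.symm hb

/-- the long diagonal of a rhombus made from two equilateral triangles is longer than a side -/
lemma diag {u v : Y} {ρ : ℝ} (hρ : 0 < ρ) (hu : ‖u‖ = ρ)
    (hv : ‖v‖ = ρ) (hvu : ‖v - u‖ = ρ) : ‖u + v‖ ≠ ρ := by
  intro h
  have hne : u + v ≠ u - v := by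
    intro h'
    have h2 : (2 : ℝ) • v = 0 := by
      have : (2 : ℝ) • v = (u + v) - (u - v) := by module
      rw [this, h', sub_self]
    have : v = 0 := by simpa using h2
    rw [this] at hv; simp at hv; linarith
  have := norm_combo_lt_of_ne h.le (by rw [← hvu, norm_sub_rev] : ‖u - v‖ ≤ ρ) hne
    (a := 1/2) (b := 1/2) (by norm_num) (by norm_num) (by norm_num)
  have e : (1/2 : ℝ) • (u + v) + (1/2 : ℝ) • (u - v) = u := by module
  rw [e] at this
  linarith

/-- Rhombus with tips `a, d` and base `b, c`. -/
lemma rhombus (hY : Module.finrank ℝ Y = 2) {a b c d : Y} {ρ : ℝ} (hρ : 0 < ρ)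
    (hab : ‖a - b‖ = ρ) (hac : ‖a - c‖ = ρ) (hbc : ‖b - c‖ = ρ)
    (hdb : ‖d - b‖ = ρ) (hdc : ‖d - c‖ = ρ) :
    d = a ∨ (d = b + c - a ∧ ‖d - a‖ ≠ ρ) := by
  rcases two_pts hY (u := c - b) (v := a - b) (w := d - b) hρ
    (by rw [norm_sub_rev, hbc]) hab (by simpa using hac) hdb (by simpa using hdc) with h | h
  · left; simpa using h
  · right
    have hd : d = b + c - a := by
      have : d = (d - b) + b := by abel
      rw [this, h]; abel
    refine ⟨hd, ?_⟩
    have := diag (u := b - a) (v := c - a) hρ (by rw [norm_sub_rev, hab])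
      (by rw [norm_sub_rev, hac]) (by rw [← hbc, norm_sub_rev]; congr 1; abel)
    rw [hd]
    convert this using 3
    abel

end Plane

section Forces
variable {E Y : Type*} [NormedAddCommGroup E] [NormedAddCommGroup Y]

/-- Some finite set forces the property `R` of all maps preserving distance `ρ` on it. -/
def Forces (ρ : ℝ) (R : (E → Y) → Prop) : Prop :=
  ∃ S : Finset E, ∀ f : E → Y,
    (∀ a ∈ S, ∀ b ∈ S, ‖a - b‖ = ρ → ‖f a - f b‖ = ρ) → R f

lemma Forces.and {ρ : ℝ} {R R' : (E → Y) → Prop} (h : Forces ρ R) (h' : Forces ρ R') :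
    Forces ρ (fun f => R f ∧ R' f) := by
  classical
  obtain ⟨S, hS⟩ := h
  obtain ⟨S', hS'⟩ := h'
  refine ⟨S ∪ S', fun f hf => ⟨hS f ?_, hS' f ?_⟩⟩
  · exact fun a ha b hb => hf a (Finset.mem_union_left _ ha) b (Finset.mem_union_left _ hb)
  · exact fun a ha b hb => hf a (Finset.mem_union_right _ ha) b (Finset.mem_union_right _ hb)

lemma Forces.mono {ρ : ℝ} {R R' : (E → Y) → Prop} (h : Forces ρ R) (h' : ∀ f, R f → R' f) :
    Forces ρ R' := by
  obtain ⟨S, hS⟩ := h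
  exact ⟨S, fun f hf => h' f (hS f hf)⟩

lemma Forces.dist {ρ : ℝ} {a b : E} (h : ‖a - b‖ = ρ) :
    Forces ρ (fun f : E → Y => ‖f a - f b‖ = ρ) := by
  classical
  exact ⟨{a, b}, fun f hf => hf a (by simp) b (by simp) h⟩

end Forces

section Main
variable {E Y : Type*} [NormedAddCommGroup E] [InnerProductSpace ℝ E]
  [NormedAddCommGroup Y] [NormedSpace ℝ Y] [StrictConvexSpace ℝ Y]

lemma norm_comb {u v : E} {ρ : ℝ} (hρ : 0 < ρ) (hu : ‖u‖ = ρ) (hv : ‖v‖ = ρ)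
    (huv : inner ℝ u v = ρ ^ 2 / 2) {α β : ℝ} (h : α ^ 2 + α * β + β ^ 2 = 1) :
    ‖α • u + β • v‖ = ρ := by
  have : ‖α • u + β • v‖ ^ 2 = ρ ^ 2 := by
    rw [norm_add_sq_real, norm_smul, norm_smul, inner_smul_left, inner_smul_right, huv, hu, hv]
    simp only [Real.norm_eq_abs, mul_pow, sq_abs, conj_trivial]
    linear_combination ρ ^ 2 * h
  exact (pow_left_inj₀ (norm_nonneg _) hρ.le two_ne_zero).1 this

lemma forces_weak (hY : Module.finrank ℝ Y = 2) {p u v : E} {ρ : ℝ} (hρ : 0 < ρ)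
    (hu : ‖u‖ = ρ) (hv : ‖v‖ = ρ) (huv : ‖u - v‖ = ρ) :
    Forces ρ (fun f : E → Y => f (p + u + v) = f p ∨
      (f (p + u + v) = f (p + u) + f (p + v) - f p ∧ ‖f (p + u + v) - f p‖ ≠ ρ)) := by
  have h1 : ‖p - (p + u)‖ = ρ := by rw [← hu, ← norm_neg]; congr 1; abel
  have h2 : ‖p - (p + v)‖ = ρ := by rw [← hv, ← norm_neg]; congr 1; abel
  have h3 : ‖(p + u) - (p + v)‖ = ρ := by rw [← huv]; congr 1; abel
  have h4 : ‖(p + u + v) - (p + u)‖ = ρ := by rw [← hv]; congr 1; abel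
  have h5 : ‖(p + u + v) - (p + v)‖ = ρ := by rw [← hu]; congr 1; abel
  refine ((Forces.dist h1).and ((Forces.dist h2).and ((Forces.dist h3).and
    ((Forces.dist h4).and (Forces.dist h5))))).mono ?_
  rintro f ⟨a1, a2, a3, a4, a5⟩
  exact rhombus hY hρ a1 a2 a3 a4 a5

/-- Moser spindle. -/
lemma forces_para (hY : Module.finrank ℝ Y = 2) {p u v : E} {ρ : ℝ} (hρ : 0 < ρ)
    (hu : ‖u‖ = ρ) (hv : ‖v‖ = ρ) (huv : inner ℝ u v = ρ ^ 2 / 2) :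
    Forces ρ (fun f : E → Y => f (p + u + v) = f (p + u) + f (p + v) - f p) := by
  obtain ⟨s, hs⟩ : ∃ s : ℝ, s ^ 2 = 11 / 108 :=
    ⟨√(11 / 108), Real.sq_sqrt (by norm_num)⟩
  have N := fun {α β : ℝ} => norm_comb (α := α) (β := β) hρ hu hv huv
  have d1 : ‖u - v‖ = ρ := by
    have := N (α := 1) (β := -1) (by norm_num)
    rw [← this]; congr 1; module
  have w1 := forces_weak (Y := Y) hY (p := p) hρ hu hv d1
  have w2 := forces_weak (Y := Y) hY (p := p) (u := (5/6 - s) • u + (2 * s) • v)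
    (v := (-2 * s) • u + (5/6 + s) • v) hρ
    (N (by linear_combination 3 * hs)) (N (by linear_combination 3 * hs))
    (by
      rw [← N (α := 5/6 + s) (β := s - 5/6) (by linear_combination 3 * hs)]
      congr 1; module)
  have w3 := Forces.dist (Y := Y) (ρ := ρ) (a := p + ((5/6 - s) • u + (2 * s) • v) +
    ((-2 * s) • u + (5/6 + s) • v)) (b := p + u + v) (by
      rw [← N (α := -1/6 - 3 * s) (β := -1/6 + 3 * s) (by linear_combination 9 * hs)]
      congr 1; module)
  refine (w1.and (w2.and w3)).mono ?_
  rintro f ⟨h1, h2, h3⟩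
  rcases h1 with h1 | h1
  · rw [h1] at h3
    rcases h2 with h2 | h2
    · rw [h2] at h3; simp at h3; linarith
    · exact absurd h3 h2.2
  · exact h1.1

lemma forces_step (hY : Module.finrank ℝ Y = 2) {p u v : E} {ρ : ℝ} (hρ : 0 < ρ)
    (hu : ‖u‖ = ρ) (hv : ‖v‖ = ρ) (huv : inner ℝ u v = ρ ^ 2 / 2) :
    Forces ρ (fun f : E → Y => f (p + u + u) = f (p + u) + (f (p + u) - f p)) := by
  have N := fun {α β : ℝ} => norm_comb (α := α) (β := β) hρ hu hv huv
  have d1 : ‖u - v‖ = ρ := by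
    have := N (α := 1) (β := -1) (by norm_num)
    rw [← this]; congr 1; module
  have w1 := forces_para (Y := Y) hY (p := p) hρ hu hv huv
  have w2 := forces_para (Y := Y) hY (p := p + v) hρ d1 hu (by
    rw [inner_sub_left, real_inner_self_eq_norm_sq, hu, real_inner_comm, huv]; ring)
  refine (w1.and w2).mono ?_
  rintro f ⟨h1, h2⟩
  have e1 : p + v + (u - v) = p + u := by abel
  have e2 : p + v + u = p + u + v := by abel
  rw [e1, e2, h1] at h2
  rw [h2]; abel

lemma forces_ray (hY : Module.finrank ℝ Y = 2)
    (hE : ∀ u : E, ∃ w : E, ‖w‖ = 1 ∧ inner ℝ u w = 0) {p u : E} {ρ : ℝ} (hρ : 0 < ρ)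
    (hu : ‖u‖ = ρ) (k : ℕ) :
    Forces ρ (fun f : E → Y => f (p + (k : ℝ) • u) = f p + (k : ℝ) • (f (p + u) - f p)) := by
  obtain ⟨w, hw, huw⟩ := hE u
  obtain ⟨s, hs⟩ : ∃ s : ℝ, s ^ 2 = 3 / 4 := ⟨√(3 / 4), Real.sq_sqrt (by norm_num)⟩
  have hv : ‖(1/2 : ℝ) • u + (s * ρ) • w‖ = ρ := by
    have : ‖(1/2 : ℝ) • u + (s * ρ) • w‖ ^ 2 = ρ ^ 2 := by
      rw [norm_add_sq_real, norm_smul, norm_smul, inner_smul_left, inner_smul_right, huw, hu, hw]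
      simp only [Real.norm_eq_abs, mul_pow, sq_abs, conj_trivial]
      linear_combination ρ ^ 2 * hs
    exact (pow_left_inj₀ (norm_nonneg _) hρ.le two_ne_zero).1 this
  have huv : inner ℝ u ((1/2 : ℝ) • u + (s * ρ) • w) = ρ ^ 2 / 2 := by
    rw [inner_add_right, inner_smul_right, inner_smul_right, huw, real_inner_self_eq_norm_sq, hu]
    ring
  have key : Forces ρ (fun f : E → Y =>
      f (p + (k : ℝ) • u) = f p + (k : ℝ) • (f (p + u) - f p) ∧
      f (p + ((k + 1 : ℕ) : ℝ) • u) = f p + ((k + 1 : ℕ) : ℝ) • (f (p + u) - f p)) := by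
    induction k with
    | zero => exact ⟨∅, fun f _ => by simp⟩
    | succ k ih =>
      refine (ih.and (forces_step (Y := Y) hY (p := p + (k : ℝ) • u) hρ hu hv huv)).mono ?_
      rintro f ⟨⟨h1, h2⟩, h3⟩
      refine ⟨h2, ?_⟩
      have e1 : p + (k : ℝ) • u + u = p + ((k + 1 : ℕ) : ℝ) • u := by push_cast; module
      have e2 : p + ((k + 1 : ℕ) : ℝ) • u + u = p + ((k + 1 + 1 : ℕ) : ℝ) • u := by
        push_cast; module
      rw [e1, e2, h1, h2] at h3
      rw [h3]; push_cast; module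
  exact key.mono fun f h => h.1

lemma forces_nat (hY : Module.finrank ℝ Y = 2)
    (hE : ∀ u : E, ∃ w : E, ‖w‖ = 1 ∧ inner ℝ u w = 0) {x y : E} {ρ : ℝ} (hρ : 0 < ρ)
    (k : ℕ) (hk : ‖x - y‖ = k * ρ) :
    Forces ρ (fun f : E → Y => ‖f x - f y‖ = k * ρ) := by
  rcases Nat.eq_zero_or_pos k with rfl | hk0
  · have : x = y := by simpa [sub_eq_zero] using hk
    subst this
    exact ⟨∅, fun f _ => by simp⟩
  have hk' : (0 : ℝ) < k := by exact_mod_cast hk0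
  have hu : ‖(k : ℝ)⁻¹ • (x - y)‖ = ρ := by
    rw [norm_smul, hk, norm_inv, Real.norm_of_nonneg hk'.le]; field_simp
  refine ((forces_ray (Y := Y) hY hE (p := y) hρ hu k).and
    (Forces.dist (a := y + (k : ℝ)⁻¹ • (x - y)) (b := y) (by simpa using hu))).mono ?_
  rintro f ⟨h1, h2⟩
  rw [smul_smul, mul_inv_cancel₀ hk'.ne', one_smul, add_sub_cancel] at h1
  rw [h1, add_sub_cancel_left, norm_smul, h2, Real.norm_of_nonneg hk'.le]

lemma forces_rat (hY : Module.finrank ℝ Y = 2)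
    (hE : ∀ u : E, ∃ w : E, ‖w‖ = 1 ∧ inner ℝ u w = 0) {x y : E} {ρ : ℝ} (hρ : 0 < ρ)
    (k m : ℕ) (hm : 0 < m) (hk : ‖x - y‖ * m = k * ρ) :
    Forces ρ (fun f : E → Y => ‖f x - f y‖ * m = k * ρ) := by
  have hm' : (0 : ℝ) < m := by exact_mod_cast hm
  obtain ⟨N, hN⟩ := exists_nat_ge (‖x - y‖ / (2 * ρ) + 1)
  have hN0 : (0 : ℝ) < N := by
    have : 0 ≤ ‖x - y‖ / (2 * ρ) := by positivity
    linarith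
  have hN1 : ‖x - y‖ / 2 ≤ N * ρ := by
    have : ‖x - y‖ / (2 * ρ) ≤ N := by linarith
    rw [div_le_iff₀ (by positivity)] at this
    linarith
  obtain ⟨w, hw, hxw⟩ := hE (x - y)
  obtain ⟨s, hs⟩ : ∃ s : ℝ, s ^ 2 = (N * ρ) ^ 2 - (‖x - y‖ / 2) ^ 2 :=
    ⟨√((N * ρ) ^ 2 - (‖x - y‖ / 2) ^ 2), Real.sq_sqrt (by
      have := pow_le_pow_left₀ (by positivity) hN1 2
      linarith)⟩
  -- `a = (x - z)/N`, `b = (y - z)/N`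
  have hnorm : ∀ α : ℝ, α ^ 2 = 1 / 4 → ‖(N : ℝ)⁻¹ • (α • (x - y) + s • w)‖ = ρ := by
    intro α hα
    have : ‖α • (x - y) + s • w‖ ^ 2 = (N * ρ) ^ 2 := by
      rw [norm_add_sq_real, norm_smul, norm_smul, inner_smul_left, inner_smul_right, hxw, hw]
      simp only [Real.norm_eq_abs, mul_pow, sq_abs, conj_trivial]
      linear_combination hs + ‖x - y‖ ^ 2 * hα
    have := (pow_left_inj₀ (norm_nonneg _) (by positivity) two_ne_zero).1 this
    rw [norm_smul, this, norm_inv, Real.norm_of_nonneg hN0.le]; field_simp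
  obtain ⟨z, hz⟩ : ∃ z : E, z = (1/2 : ℝ) • (x + y) - s • w := ⟨_, rfl⟩
  have ha : ‖(N : ℝ)⁻¹ • (x - z)‖ = ρ := by
    rw [← hnorm (1/2) (by norm_num), hz]; congr 2; module
  have hb : ‖(N : ℝ)⁻¹ • (y - z)‖ = ρ := by
    rw [← hnorm (-1/2) (by norm_num), hz]; congr 2; module
  have key : ∀ t : E, ‖(N : ℝ)⁻¹ • (t - z)‖ = ρ →
      Forces ρ (fun f : E → Y => f (z + (m : ℝ) • (t - z)) = f z + (m : ℝ) • (f t - f z)) := by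
    intro t ht
    refine ((forces_ray (Y := Y) hY hE (p := z) hρ ht N).and
      (forces_ray (Y := Y) hY hE (p := z) hρ ht (m * N))).mono ?_
    rintro f ⟨h1, h2⟩
    rw [smul_smul, mul_inv_cancel₀ hN0.ne', one_smul, add_sub_cancel] at h1
    rw [smul_smul, Nat.cast_mul, mul_assoc, mul_inv_cancel₀ hN0.ne', mul_one] at h2
    rw [h2, h1]; module
  have hAB : ‖(z + (m : ℝ) • (x - z)) - (z + (m : ℝ) • (y - z))‖ = k * ρ := by
    have e : (z + (m : ℝ) • (x - z)) - (z + (m : ℝ) • (y - z)) = (m : ℝ) • (x - y) := by module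
    rw [e, norm_smul, Real.norm_of_nonneg hm'.le, mul_comm, hk]
  refine ((key x ha).and ((key y hb).and (forces_nat (Y := Y) hY hE hρ k hAB))).mono ?_
  rintro f ⟨h1, h2, h3⟩
  have e : (f z + (m : ℝ) • (f x - f z)) - (f z + (m : ℝ) • (f y - f z))
    = (m : ℝ) • (f x - f y) := by module
  rw [h1, h2, e, norm_smul, Real.norm_of_nonneg hm'.le] at h3
  rw [mul_comm, h3]

end Main

lemma exists_perp {n : ℕ} (hn : 2 ≤ n) (u : EuclideanSpace ℝ (Fin n)) :
    ∃ w : EuclideanSpace ℝ (Fin n), ‖w‖ = 1 ∧ inner ℝ u w = 0 := by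
  have h1 := (ℝ ∙ u).finrank_add_finrank_orthogonal
  have h2 : Module.finrank ℝ (ℝ ∙ u) ≤ 1 :=
    (finrank_span_le_card ({u} : Set (EuclideanSpace ℝ (Fin n)))).trans (by simp)
  rw [finrank_euclideanSpace_fin] at h1
  have h3 : 0 < Module.finrank ℝ (ℝ ∙ u)ᗮ := by omega
  have : Nontrivial (ℝ ∙ u)ᗮ := Module.finrank_pos_iff.1 h3
  obtain ⟨w, hw⟩ := exists_norm_eq (ℝ ∙ u)ᗮ (zero_le_one' ℝ)
  exact ⟨w, by simpa using hw, Submodule.mem_orthogonal_singleton_iff_inner_right.1 w.2⟩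

end DBQ

/-- Item 3 of the Theorem: for euclidean `ℝⁿ` (`2 ≤ n`) the assumption of injectivity is
unnecessary: if `‖x - y‖ / ρ` is rational, there is a finite set `S` containing `x` and
`y` such that every (not necessarily injective) map `f : S → Y` preserving the distance
`ρ` preserves the distance between `x` and `y`. -/
theorem discrete_beckman_quarles_euclidean {Y : Type*}
    [NormedAddCommGroup Y] [NormedSpace ℝ Y]
    (hY : Module.finrank ℝ Y = 2)
    (hsc : ∀ a b : Y, a ≠ 0 → b ≠ 0 → ‖a + b‖ = ‖a‖ + ‖b‖ → ∃ γ : ℝ, 0 < γ ∧ a = γ • b)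
    (n : ℕ) (hn : 2 ≤ n) (ρ : ℝ) (hρ : 0 < ρ)
    (x y : EuclideanSpace ℝ (Fin n)) (hq : ∃ q : ℚ, ‖x - y‖ / ρ = (q : ℝ)) :
    ∃ S : Finset (EuclideanSpace ℝ (Fin n)), x ∈ S ∧ y ∈ S ∧
      ∀ f : EuclideanSpace ℝ (Fin n) → Y,
        (∀ a ∈ S, ∀ b ∈ S, ‖a - b‖ = ρ → ‖f a - f b‖ = ρ) →
        ‖f x - f y‖ = ‖x - y‖ := by
  classical
  haveI := DBQ.strict_of hsc
  obtain ⟨q, hq⟩ := hq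
  have hq0 : 0 ≤ q := by
    have : 0 ≤ ‖x - y‖ / ρ := by positivity
    rw [hq] at this
    exact_mod_cast this
  have hden : (0 : ℝ) < q.den := by exact_mod_cast q.den_pos
  have hqq : (q : ℝ) * q.den = q.num.toNat := by
    have h1 : q * q.den = q.num := Rat.mul_den_eq_num q
    have h2 : ((q.num.toNat : ℤ) : ℚ) = (q.num : ℚ) := by
      rw [Int.toNat_of_nonneg (Rat.num_nonneg.2 hq0)]
    rw [← h2] at h1
    exact_mod_cast h1
  have hk : ‖x - y‖ * q.den = q.num.toNat * ρ := by
    rw [div_eq_iff hρ.ne'] at hq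
    rw [hq, ← hqq]; ring
  obtain ⟨S, hS⟩ := DBQ.forces_rat (Y := Y) hY (DBQ.exists_perp hn) hρ q.num.toNat q.den
    q.den_pos hk
  refine ⟨insert x (insert y S), by simp, by simp, fun f hf => ?_⟩
  have := hS f fun a ha b hb => hf a (by simp [ha]) b (by simp [hb])
  exact mul_right_cancel₀ hden.ne' (this.trans hk.symm)
end

section
/- Let X and Y be real normed spaces with dim X ≥ dim Y = 2, Y strictly convex, and ρ > 0. Then every map f : X → Y (not assumed injective) that preserves the distance ρ is an isometry. -/
namespace BQ

lemma cvx {E : Type*} [NormedAddCommGroup E] [NormedSpace ℝ E] (p a : E) {s m e : ℝ}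
    (h1 : s < m) (h2 : m < e) :
    (e - s) * ‖p + m • a‖ ≤ (e - m) * ‖p + s • a‖ + (m - s) * ‖p + e • a‖ := by
  have h : (e - s) • (p + m • a) = (e - m) • (p + s • a) + (m - s) • (p + e • a) := by module
  calc (e - s) * ‖p + m • a‖ = ‖(e - s) • (p + m • a)‖ := by
        rw [norm_smul, Real.norm_of_nonneg (by linarith)]
    _ ≤ ‖(e - m) • (p + s • a)‖ + ‖(m - s) • (p + e • a)‖ := by rw [h]; exact norm_add_le _ _
    _ = _ := by
        rw [norm_smul, norm_smul, Real.norm_of_nonneg (by linarith : 0 ≤ e - m),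
          Real.norm_of_nonneg (by linarith : 0 ≤ m - s)]

lemma cvx_r {E : Type*} [NormedAddCommGroup E] [NormedSpace ℝ E] (p a : E) {s m e : ℝ}
    (h1 : s < m) (h2 : m < e) (hs : ‖p + s • a‖ ≤ 1) (he : ‖p + e • a‖ < 1) :
    ‖p + m • a‖ < 1 := by
  have := cvx p a h1 h2
  by_contra hc
  push Not at hc
  nlinarith

lemma cvx_l {E : Type*} [NormedAddCommGroup E] [NormedSpace ℝ E] (p a : E) {s m e : ℝ}
    (h1 : s < m) (h2 : m < e) (hs : ‖p + s • a‖ < 1) (he : ‖p + e • a‖ ≤ 1) :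
    ‖p + m • a‖ < 1 := by
  have := cvx p a h1 h2
  by_contra hc
  push Not at hc
  nlinarith

/-- equilateral unit pair -/
def Eq3 {E : Type*} [NormedAddCommGroup E] (a b : E) : Prop :=
  ‖a‖ = 1 ∧ ‖b‖ = 1 ∧ ‖a - b‖ = 1

lemma alpha_ge {E : Type*} [NormedAddCommGroup E] [NormedSpace ℝ E] {a b c : E} {α β : ℝ}
    (hb : Eq3 a b) (hc : Eq3 a c) (hα : 0 < α) (h : c = α • b + β • a) : 1 ≤ α := by
  by_contra hlt
  push Not at hlt
  obtain ⟨ha, hb1, hb2⟩ := hb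
  obtain ⟨-, hc1, hc2⟩ := hc
  have g0 : ‖α • b + (0:ℝ) • a‖ < 1 := by
    rw [zero_smul, add_zero, norm_smul, hb1, Real.norm_of_nonneg hα.le]; linarith
  have gm : ‖α • b + (-1:ℝ) • a‖ ≤ 1 := by
    have e : α • b + (-1:ℝ) • a = (-α) • (a - b) + (-(1 - α)) • a := by module
    rw [e]
    refine (norm_add_le _ _).trans ?_
    rw [norm_smul, norm_smul, ha, hb2, norm_neg, norm_neg, Real.norm_of_nonneg hα.le,
      Real.norm_of_nonneg (by linarith)]
    linarith
  have gb : ‖α • b + β • a‖ = 1 := by rw [← h, hc1]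
  have gb1 : ‖α • b + (β - 1) • a‖ = 1 := by
    refine Eq.trans ?_ hc2
    rw [h, ← norm_neg]; congr 1; module
  rcases lt_trichotomy β 0 with hβ | hβ | hβ
  · have := cvx_r (α • b) a (by linarith : β - 1 < β) hβ gb1.le g0
    linarith
  · rw [hβ] at gb; linarith
  · rcases lt_trichotomy β 1 with hβ' | hβ' | hβ'
    · have := cvx_r (α • b) a (by linarith : -1 < β - 1) (by linarith) gm g0
      linarith
    · rw [hβ', sub_self] at gb1; linarith
    · have := cvx_l (α • b) a (by linarith : 0 < β - 1) (by linarith : β - 1 < β) g0 gb.le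
      linarith

lemma seg_aux {E : Type*} [NormedAddCommGroup E] [NormedSpace ℝ E] {a b : E} {β s : ℝ}
    (hb : Eq3 a b) (hc : Eq3 a (b + β • a)) (hs : 0 < s) (hsβ : s < β) :
    Eq3 a (b + s • a) := by
  obtain ⟨ha, hb1, hb2⟩ := hb
  obtain ⟨-, hc1, hc2⟩ := hc
  have h0 : ‖b + (0:ℝ) • a‖ = 1 := by rw [zero_smul, add_zero, hb1]
  have hm : ‖b + (-1:ℝ) • a‖ = 1 := by
    refine Eq.trans ?_ hb2
    rw [← norm_neg]; congr 1; module
  have hbm : ‖b + (β - 1) • a‖ = 1 := by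
    refine Eq.trans ?_ hc2
    rw [← norm_neg]; congr 1; module
  refine ⟨ha, le_antisymm ?_ ?_, ?_⟩
  · have := cvx b a hs hsβ
    rw [h0, hc1] at this
    nlinarith
  · by_contra hlt
    push Not at hlt
    have := cvx_r b a (by norm_num : (-1:ℝ) < 0) hs hm.le hlt
    linarith
  · have e : ‖a - (b + s • a)‖ = ‖b + (s - 1) • a‖ := by
      rw [← norm_neg]; congr 1; module
    rw [e]
    apply le_antisymm
    · have := cvx b a (by linarith : -1 < s - 1) (by linarith : s - 1 < β - 1)
      rw [hm, hbm] at this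
      nlinarith
    · by_contra hlt
      push Not at hlt
      have := cvx_l b a (by linarith : s - 1 < β - 1) (by linarith : β - 1 < β) hlt hc1.le
      linarith

lemma fiber {E : Type*} [NormedAddCommGroup E] [NormedSpace ℝ E] {a b c : E} {α β : ℝ}
    (hb : Eq3 a b) (hc : Eq3 a c) (hα : 0 < α) (h : c = α • b + β • a) :
    c = b + β • a ∧ ∀ t : ℝ, 0 ≤ t → t ≤ 1 → Eq3 a (b + t • (c - b)) := by
  have h1 := alpha_ge hb hc hα h
  have h2 : 1 ≤ α⁻¹ := by
    refine alpha_ge (β := -(α⁻¹ * β)) hc hb (inv_pos.2 hα) ?_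
    rw [h, smul_add, smul_smul, smul_smul, inv_mul_cancel₀ hα.ne']
    module
  have h3 : α = 1 := le_antisymm ((one_le_inv₀ hα).1 h2) h1
  rw [h3, one_smul] at h
  refine ⟨h, fun t ht0 ht1 => ?_⟩
  rcases ht0.eq_or_lt with rfl | ht0
  · simpa using hb
  rcases ht1.eq_or_lt with rfl | ht1
  · simpa using hc
  rcases lt_trichotomy β 0 with hβ | hβ | hβ
  · have e : b + t • (c - b) = c + ((1 - t) * (-β)) • a := by rw [h]; module
    rw [e]
    refine seg_aux (β := -β) hc ?_ (by nlinarith) (by nlinarith)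
    convert hb using 1
    rw [h]; module
  · subst hβ
    simp at h
    simpa [h] using hb
  · have e : b + t • (c - b) = b + (t * β) • a := by rw [h]; module
    rw [e]
    exact seg_aux hb (h ▸ hc) (by nlinarith) (by nlinarith)

lemma coords {P : Type*} [NormedAddCommGroup P] [NormedSpace ℝ P]
    (hP : Module.finrank ℝ P = 2) :
    ∃ p q : P →L[ℝ] ℝ, ∀ v, p v = 0 → q v = 0 → v = 0 := by
  have : FiniteDimensional ℝ P := Module.finite_of_finrank_pos (by omega)
  let B := Module.finBasisOfFinrankEq ℝ P hP
  refine ⟨(B.coord 0).toContinuousLinearMap, (B.coord 1).toContinuousLinearMap, ?_⟩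
  intro v h0 h1
  apply B.ext_elem
  intro i
  fin_cases i
  · simpa using h0
  · simpa using h1

lemma det_ne {P : Type*} [NormedAddCommGroup P] [NormedSpace ℝ P] {p q : P →L[ℝ] ℝ}
    (hpq : ∀ v, p v = 0 → q v = 0 → v = 0) {a b : P} (h : Eq3 a b) :
    p a * q b - q a * p b ≠ 0 := by
  intro h0
  obtain ⟨ha, hb, hab⟩ := h
  have key : ∃ k : ℝ, b = k • a := by
    have e1 : p a • b = p b • a := by
      rw [← sub_eq_zero]; apply hpq <;> simp <;> linarith
    have e2 : q a • b = q b • a := by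
      rw [← sub_eq_zero]; apply hpq <;> simp <;> linarith
    by_cases hp : p a = 0
    · have hq : q a ≠ 0 := by
        intro hq
        have := hpq a hp hq
        rw [this] at ha; simp at ha
      exact ⟨(q a)⁻¹ * q b, by rw [mul_smul, ← e2, inv_smul_smul₀ hq]⟩
    · exact ⟨(p a)⁻¹ * p b, by rw [mul_smul, ← e1, inv_smul_smul₀ hp]⟩
  obtain ⟨k, rfl⟩ := key
  have e : a - k • a = (1 - k) • a := by module
  rw [e, norm_smul, ha, Real.norm_eq_abs, mul_one] at hab
  rw [norm_smul, ha, Real.norm_eq_abs, mul_one] at hb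
  rcases abs_eq (by norm_num : (0:ℝ) ≤ 1) |>.1 hb with h | h <;> rw [h] at hab <;> norm_num at hab

lemma plucker {P : Type*} [NormedAddCommGroup P] [NormedSpace ℝ P] {p q : P →L[ℝ] ℝ}
    (hpq : ∀ v, p v = 0 → q v = 0 → v = 0) {a b c : P} (h : p a * q b - q a * p b ≠ 0) :
    c = ((p a * q c - q a * p c) / (p a * q b - q a * p b)) • b +
      ((p c * q b - q c * p b) / (p a * q b - q a * p b)) • a := by
  rw [← sub_eq_zero]
  apply hpq <;> simp <;> field_simp <;> ring

lemma ivt {E : Type*} [NormedAddCommGroup E] [NormedSpace ℝ E] (hE : 2 ≤ Module.rank ℝ E)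
    (a b : E) (r s : ℝ) (hab : a ≠ b) (hr : 0 < r) (hs : 0 < s)
    (h1 : r - s ≤ ‖a - b‖) (h2 : s - r ≤ ‖a - b‖) (h3 : ‖a - b‖ ≤ r + s) :
    ∃ c, ‖c - a‖ = r ∧ ‖c - b‖ = s := by
  have hd : 0 < ‖a - b‖ := norm_pos_iff.2 (sub_ne_zero.2 hab)
  set d := ‖a - b‖ with hdd
  have hcon := (isConnected_sphere (E := E)
    (lt_of_lt_of_le (by exact_mod_cast Nat.one_lt_two) hE) a hr.le).isPreconnected
  have hcont : ContinuousOn (fun c : E => ‖c - b‖) (Metric.sphere a r) := by fun_prop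
  have m1 : a - (r / d) • (a - b) ∈ Metric.sphere a r := by
    rw [mem_sphere_iff_norm, sub_sub_cancel_left, norm_neg, norm_smul,
      Real.norm_of_nonneg (by positivity), ← hdd]
    field_simp
  have m2 : a + (r / d) • (a - b) ∈ Metric.sphere a r := by
    rw [mem_sphere_iff_norm, add_sub_cancel_left, norm_smul,
      Real.norm_of_nonneg (by positivity), ← hdd]
    field_simp
  have v1 : ‖a - (r / d) • (a - b) - b‖ ≤ s := by
    have e : a - (r / d) • (a - b) - b = (1 - r / d) • (a - b) := by module
    rw [e, norm_smul, Real.norm_eq_abs, ← hdd, ← abs_of_pos hd, ← abs_mul, abs_of_pos hd, abs_le]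
    have : (1 - r / d) * d = d - r := by field_simp
    rw [this]
    constructor <;> linarith
  have v2 : s ≤ ‖a + (r / d) • (a - b) - b‖ := by
    have e : a + (r / d) • (a - b) - b = (1 + r / d) • (a - b) := by module
    rw [e, norm_smul, Real.norm_of_nonneg (by positivity), ← hdd]
    have : (1 + r / d) * d = d + r := by field_simp
    rw [this]
    linarith
  obtain ⟨c, hc, hc'⟩ := hcon.intermediate_value m1 m2 hcont ⟨v1, v2⟩
  exact ⟨c, by rwa [mem_sphere_iff_norm] at hc, hc'⟩

lemma exists_tri {E : Type*} [NormedAddCommGroup E] [NormedSpace ℝ E]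
    (hE : 2 ≤ Module.rank ℝ E) (a : E) (r : ℝ) (hr : 0 < r) (ha : ‖a‖ = r) :
    ∃ b : E, ‖b‖ = r ∧ ‖a - b‖ = r := by
  have h0 : a ≠ 0 := by rintro rfl; simp at ha; linarith
  obtain ⟨c, h1, h2⟩ := ivt hE 0 a r r h0.symm hr hr (by simp) (by simp) (by simp [ha]; linarith)
  exact ⟨c, by simpa using h1, by rw [norm_sub_rev]; exact h2⟩

lemma eq3_sum {E : Type*} [NormedAddCommGroup E] [NormedSpace ℝ E] {a b : E} (h : Eq3 a b) :
    1 ≤ ‖a + b‖ := by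
  obtain ⟨ha, hb, hab⟩ := h
  have e : (2:ℝ) • a = (a + b) + (a - b) := by module
  have := norm_add_le (a + b) (a - b)
  rw [← e, norm_smul, ha, hab] at this
  norm_num at this
  linarith

lemma eq3_neg {E : Type*} [NormedAddCommGroup E] {a b : E} (h : Eq3 a b) : Eq3 (-a) (-b) := by
  obtain ⟨ha, hb, hab⟩ := h
  refine ⟨by simpa using ha, by simpa using hb, ?_⟩
  rw [← norm_neg, ← hab]; congr 1; abel

lemma eq3_refl {E : Type*} [NormedAddCommGroup E] {a b : E} (h : Eq3 a b) : Eq3 a (a - b) := by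
  obtain ⟨ha, hb, hab⟩ := h
  exact ⟨ha, hab, by rw [sub_sub_cancel, hb]⟩

lemma moser2_aux {P : Type*} [NormedAddCommGroup P] [NormedSpace ℝ P]
    (hP : Module.finrank ℝ P = 2) {p q : P →L[ℝ] ℝ}
    (hpq : ∀ v, p v = 0 → q v = 0 → v = 0)
    {x y : P} (h : Eq3 x y) (hxy : 0 < p x * q y - q x * p y) :
    ∃ x' y', Eq3 x' y' ∧ ‖x + y - (x' + y')‖ = 1 := by
  have hfd : FiniteDimensional ℝ P := Module.finite_of_finrank_pos (by omega)
  have hprop : ProperSpace P := FiniteDimensional.proper ℝ P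
  have hrank : 2 ≤ Module.rank ℝ P := by
    rw [← Module.finrank_eq_rank, hP]; norm_num
  let E : Set (P × P) := {z | Eq3 z.1 z.2 ∧ 0 ≤ p z.1 * q z.2 - q z.1 * p z.2}
  have hEcl : IsClosed E := by
    have : E = {z | ‖z.1‖ = 1} ∩ ({z | ‖z.2‖ = 1} ∩ {z | ‖z.1 - z.2‖ = 1}) ∩
      {z | 0 ≤ p z.1 * q z.2 - q z.1 * p z.2} := by
      ext z; simp [E, Eq3]
    rw [this]
    refine ((isClosed_eq (by fun_prop) (by fun_prop)).inter
      ((isClosed_eq (by fun_prop) (by fun_prop)).inter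
        (isClosed_eq (by fun_prop) (by fun_prop)))).inter
        (isClosed_le (by fun_prop) (by fun_prop))
  have hEc : IsCompact E := by
    refine ((isCompact_sphere (0:P) 1).prod (isCompact_sphere (0:P) 1)).of_isClosed_subset hEcl ?_
    rintro ⟨u, v⟩ ⟨⟨h1, h2, -⟩, -⟩
    exact ⟨by simpa using h1, by simpa using h2⟩
  let g : P × P → ℝ := fun z => ‖x + y - (z.1 + z.2)‖
  have hg : Continuous g := by fun_prop
  have hE1 : IsClosed (Prod.fst '' (E ∩ {z | g z ≤ 1})) :=
    ((hEc.inter_right (isClosed_le hg continuous_const)).image continuous_fst).isClosed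
  have hE2 : IsClosed (Prod.fst '' (E ∩ {z | 1 ≤ g z})) :=
    ((hEc.inter_right (isClosed_le continuous_const hg)).image continuous_fst).isClosed
  have hcon := (isConnected_sphere (E := P)
    (lt_of_lt_of_le (by exact_mod_cast Nat.one_lt_two) hrank) 0 zero_le_one).isPreconnected
  rw [isPreconnected_closed_iff] at hcon
  have hxE : (x, y) ∈ E := ⟨h, hxy.le⟩
  have hxE' : (-x, -y) ∈ E := ⟨eq3_neg h, by simpa using hxy.le⟩
  obtain ⟨a, -, ⟨⟨a1, b1⟩, ⟨⟨hb1, hd1⟩, hg1⟩, rfl⟩, ⟨⟨a2, b2⟩, ⟨⟨hb2, hd2⟩, hg2⟩, haa⟩⟩ :=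
    hcon _ _ hE1 hE2 (by
      intro a ha
      have ha1 : ‖a‖ = 1 := by simpa using ha
      have : ∃ b, (a, b) ∈ E := by
        obtain ⟨b, hb, hab⟩ := exists_tri hrank a 1 one_pos ha1
        have hab : Eq3 a b := ⟨ha1, hb, hab⟩
        rcases le_total 0 (p a * q b - q a * p b) with h0 | h0
        · exact ⟨b, hab, h0⟩
        · refine ⟨a - b, eq3_refl hab, ?_⟩
          simp only [map_sub]
          linarith
      obtain ⟨b, hb⟩ := this
      rcases le_total (g (a, b)) 1 with h0 | h0
      · exact Or.inl ⟨_, ⟨hb, h0⟩, rfl⟩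
      · exact Or.inr ⟨_, ⟨hb, h0⟩, rfl⟩)
      ⟨x, by simpa using h.1, (x, y), ⟨hxE, by simp [g]⟩, rfl⟩
      ⟨-x, by simpa using h.1, (-x, -y), ⟨hxE', by
        have e : x + y - (-x + -y) = (2:ℝ) • (x + y) := by module
        have := eq3_sum h
        simp only [g, Set.mem_setOf_eq, e, norm_smul]
        norm_num
        linarith⟩, rfl⟩
  simp only at haa hb1 hb2 hd1 hd2
  subst haa
  have hn1 := det_ne hpq hb1
  have hn2 := det_ne hpq hb2
  have hp1 := lt_of_le_of_ne hd1 hn1.symm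
  have hp2 := lt_of_le_of_ne hd2 hn2.symm
  have hf := (fiber hb1 hb2 (div_pos hp2 hp1) (plucker hpq hn1)).2
  have hc : ContinuousOn (fun t : ℝ => g (a2, b1 + t • (b2 - b1))) (Set.Icc 0 1) := by fun_prop
  obtain ⟨t, ht, ht'⟩ := intermediate_value_Icc zero_le_one hc
    (show (1:ℝ) ∈ Set.Icc _ _ from ⟨by simpa using hg1, by simpa using hg2⟩)
  exact ⟨a2, _, hf t ht.1 ht.2, ht'⟩

lemma moser2 {P : Type*} [NormedAddCommGroup P] [NormedSpace ℝ P]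
    (hP : Module.finrank ℝ P = 2) {x y : P} (h : Eq3 x y) :
    ∃ x' y', Eq3 x' y' ∧ ‖x + y - (x' + y')‖ = 1 := by
  obtain ⟨p, q, hpq⟩ := coords hP
  rcases lt_or_gt_of_ne (det_ne hpq h) with h0 | h0
  · exact moser2_aux hP (p := q) (q := p) (fun v h1 h2 => hpq v h2 h1) h (by linarith)
  · exact moser2_aux hP hpq h h0

lemma eq3_li {E : Type*} [NormedAddCommGroup E] [NormedSpace ℝ E] {a b : E} (h : Eq3 a b) :
    LinearIndependent ℝ ![a, b] := by
  obtain ⟨ha, hb, hab⟩ := h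
  have ha0 : a ≠ 0 := by rintro rfl; simp at ha
  rw [LinearIndependent.pair_iff' ha0]
  rintro k rfl
  have e : a - k • a = (1 - k) • a := by module
  rw [e, norm_smul, ha, Real.norm_eq_abs, mul_one] at hab
  rw [norm_smul, ha, Real.norm_eq_abs, mul_one] at hb
  rcases abs_eq (by norm_num : (0:ℝ) ≤ 1) |>.1 hb with h | h <;> rw [h] at hab <;> norm_num at hab

lemma moser {E : Type*} [NormedAddCommGroup E] [NormedSpace ℝ E] {x y : E} (h : Eq3 x y) :
    ∃ x' y', Eq3 x' y' ∧ ‖x + y - (x' + y')‖ = 1 := by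
  have hfr := finrank_span_eq_card (eq3_li h)
  let P := Submodule.span ℝ (Set.range ![x, y])
  have hx : x ∈ P := Submodule.subset_span ⟨0, rfl⟩
  have hy : y ∈ P := Submodule.subset_span ⟨1, rfl⟩
  obtain ⟨x', y', h1, h2⟩ := moser2 (P := P) (by simpa using hfr) (x := ⟨x, hx⟩) (y := ⟨y, hy⟩) h
  exact ⟨x', y', h1, h2⟩

section Y
variable {X Y : Type*}
    [NormedAddCommGroup X] [NormedSpace ℝ X] [NormedAddCommGroup Y] [NormedSpace ℝ Y]

lemma two_pts (hY : Module.finrank ℝ Y = 2)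
    (hsc : ∀ a b : Y, a ≠ 0 → b ≠ 0 → ‖a + b‖ = ‖a‖ + ‖b‖ → ∃ γ : ℝ, 0 < γ ∧ a = γ • b)
    {a b c : Y} (hb : Eq3 a b) (hc : Eq3 a c) : c = b ∨ c = a - b := by
  obtain ⟨p, q, hpq⟩ := coords hY
  have hn1 := det_ne hpq hb
  have main : ∀ c : Y, Eq3 a c →
      0 < (p a * q c - q a * p c) / (p a * q b - q a * p b) → c = b := by
    intro c hc hpos
    have hm := ((fiber hb hc hpos (plucker hpq hn1)).2 (1/2) (by norm_num) (by norm_num)).2.1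
    have e : b + (1/2:ℝ) • (c - b) = (1/2:ℝ) • (c + b) := by module
    rw [e, norm_smul] at hm
    norm_num at hm
    have hc1 := hc.2.1
    have hb1 := hb.2.1
    obtain ⟨γ, hγ, h⟩ := hsc c b (by rintro rfl; simp at hc1) (by rintro rfl; simp at hb1)
      (by rw [hc1, hb1]; linarith)
    rw [h, norm_smul, hb1, Real.norm_of_nonneg hγ.le, mul_one] at hc1
    rw [h, hc1, one_smul]
  rcases lt_or_gt_of_ne (div_ne_zero (det_ne hpq hc) hn1) with h0 | h0
  · right
    rw [← main (a - c) (eq3_refl hc) (by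
      have : (p a * q (a - c) - q a * p (a - c)) = -(p a * q c - q a * p c) := by
        simp only [map_sub]; ring
      rw [this, neg_div]; linarith)]
    abel
  · exact Or.inl (main c hc h0)

lemma sum_ne (hsc : ∀ a b : Y, a ≠ 0 → b ≠ 0 → ‖a + b‖ = ‖a‖ + ‖b‖ → ∃ γ : ℝ, 0 < γ ∧ a = γ • b)
    {a b : Y} (h : Eq3 a b) : ‖a + b‖ ≠ 1 := by
  intro h1
  obtain ⟨ha, hb, hab⟩ := h
  obtain ⟨γ, hγ, he⟩ := hsc (a + b) (a - b) (by intro h; simp [h] at h1)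
    (by intro h; simp [h] at hab) (by
      have e : (a + b) + (a - b) = (2:ℝ) • a := by module
      rw [e, norm_smul, ha, h1, hab]; norm_num)
  rw [he, norm_smul, hab, Real.norm_of_nonneg hγ.le, mul_one] at h1
  rw [h1, one_smul] at he
  have : (2:ℝ) • b = (a + b) - (a - b) := by module
  rw [he, sub_self] at this
  have hb0 : b = 0 := by simpa using this
  simp [hb0] at hb

lemma para_alt (hY : Module.finrank ℝ Y = 2)
    (hsc : ∀ a b : Y, a ≠ 0 → b ≠ 0 → ‖a + b‖ = ‖a‖ + ‖b‖ → ∃ γ : ℝ, 0 < γ ∧ a = γ • b)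
    (f : X → Y) (hf : ∀ a b : X, ‖a - b‖ = 1 → ‖f a - f b‖ = 1) (z : X) {x y : X}
    (h : Eq3 x y) :
    f (z + (x + y)) = f z ∨ f (z + (x + y)) = f (z + x) + f (z + y) - f z := by
  obtain ⟨hx, hy, hxy⟩ := h
  have h1 : Eq3 (f (z + y) - f (z + x)) (f z - f (z + x)) := by
    refine ⟨hf _ _ ?_, hf _ _ ?_, ?_⟩
    · rw [← hxy, ← norm_neg]; congr 1; abel
    · rw [← hx, ← norm_neg]; congr 1; abel
    · rw [sub_sub_sub_cancel_right]
      apply hf; rw [← hy]; congr 1; abel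
  have h2 : Eq3 (f (z + y) - f (z + x)) (f (z + (x + y)) - f (z + x)) := by
    refine ⟨h1.1, hf _ _ ?_, ?_⟩
    · rw [← hy]; congr 1; abel
    · rw [sub_sub_sub_cancel_right]
      apply hf; rw [← hx, ← norm_neg]; congr 1; abel
  rcases two_pts hY hsc h1 h2 with h | h
  · left; exact sub_left_injective h
  · right
    rw [sub_eq_iff_eq_add] at h
    rw [h]; abel

lemma para1 (hY : Module.finrank ℝ Y = 2)
    (hsc : ∀ a b : Y, a ≠ 0 → b ≠ 0 → ‖a + b‖ = ‖a‖ + ‖b‖ → ∃ γ : ℝ, 0 < γ ∧ a = γ • b)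
    (f : X → Y) (hf : ∀ a b : X, ‖a - b‖ = 1 → ‖f a - f b‖ = 1) (z : X) {x y : X}
    (h : Eq3 x y) :
    f (z + (x + y)) = f (z + x) + f (z + y) - f z := by
  rcases para_alt hY hsc f hf z h with h0 | h0
  swap
  · exact h0
  exfalso
  obtain ⟨x', y', h', hm⟩ := moser h
  have hd : ‖f (z + (x' + y')) - f z‖ = 1 := by
    rw [← h0]; apply hf; rw [← hm, ← norm_neg]; congr 1; abel
  rcases para_alt hY hsc f hf z h' with h1 | h1
  · rw [h1] at hd; simp at hd
  · refine sum_ne hsc (a := f (z + x') - f z) (b := f (z + y') - f z) ?_ ?_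
    · obtain ⟨hx, hy, hxy⟩ := h'
      refine ⟨hf _ _ ?_, hf _ _ ?_, ?_⟩
      · simpa using hx
      · simpa using hy
      · rw [sub_sub_sub_cancel_right]; apply hf; simpa using hxy
    · rw [← hd, h1]; congr 1; abel

lemma para (hY : Module.finrank ℝ Y = 2)
    (hsc : ∀ a b : Y, a ≠ 0 → b ≠ 0 → ‖a + b‖ = ‖a‖ + ‖b‖ → ∃ γ : ℝ, 0 < γ ∧ a = γ • b)
    {ρ : ℝ} (hρ : 0 < ρ)
    (f : X → Y) (hf : ∀ a b : X, ‖a - b‖ = ρ → ‖f a - f b‖ = ρ) (z : X) {x y : X}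
    (hx : ‖x‖ = ρ) (hy : ‖y‖ = ρ) (hxy : ‖x - y‖ = ρ) :
    f (z + (x + y)) = f (z + x) + f (z + y) - f z := by
  have key := para1 hY hsc (fun a => ρ⁻¹ • f (ρ • a)) (by
    intro a b hab
    rw [← smul_sub, norm_smul, hf, norm_inv, Real.norm_of_nonneg hρ.le, inv_mul_cancel₀ hρ.ne']
    rw [← smul_sub, norm_smul, hab, Real.norm_of_nonneg hρ.le, mul_one])
    (ρ⁻¹ • z) (x := ρ⁻¹ • x) (y := ρ⁻¹ • y) (by
      refine ⟨?_, ?_, ?_⟩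
      · rw [norm_smul, hx, norm_inv, Real.norm_of_nonneg hρ.le, inv_mul_cancel₀ hρ.ne']
      · rw [norm_smul, hy, norm_inv, Real.norm_of_nonneg hρ.le, inv_mul_cancel₀ hρ.ne']
      · rw [← smul_sub, norm_smul, hxy, norm_inv, Real.norm_of_nonneg hρ.le,
          inv_mul_cancel₀ hρ.ne'])
  simp only [smul_add, smul_inv_smul₀ hρ.ne'] at key
  rw [← smul_add, ← smul_sub] at key
  simpa using smul_right_injective Y (inv_ne_zero hρ.ne') key

lemma line (hX : 2 ≤ Module.rank ℝ X) (hY : Module.finrank ℝ Y = 2)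
    (hsc : ∀ a b : Y, a ≠ 0 → b ≠ 0 → ‖a + b‖ = ‖a‖ + ‖b‖ → ∃ γ : ℝ, 0 < γ ∧ a = γ • b)
    {ρ : ℝ} (hρ : 0 < ρ)
    (f : X → Y) (hf : ∀ a b : X, ‖a - b‖ = ρ → ‖f a - f b‖ = ρ) (z : X) {x : X}
    (hx : ‖x‖ = ρ) (n : ℕ) :
    f (z + (n:ℝ) • x) = f z + (n:ℝ) • (f (z + x) - f z) := by
  have step : ∀ w, f (w + x + x) - f (w + x) = f (w + x) - f w := by
    intro w
    obtain ⟨y, hy, hxy⟩ := exists_tri hX x ρ hρ hx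
    have h1 := para hY hsc hρ f hf w hx hy hxy
    have h2 := para hY hsc hρ f hf (w + y) hx hxy (by rw [sub_sub_cancel, hy])
    have e1 : w + y + (x + (x - y)) = w + x + x := by abel
    have e2 : w + y + x = w + (x + y) := by abel
    have e3 : w + y + (x - y) = w + x := by abel
    rw [e1, e2, e3, h1] at h2
    rw [h2]; abel
  have step' : ∀ n : ℕ, f (z + (n:ℝ) • x + x) - f (z + (n:ℝ) • x) = f (z + x) - f z := by
    intro n
    induction n with
    | zero => simp
    | succ n ih =>
      have e : z + ((n + 1 : ℕ):ℝ) • x = z + (n:ℝ) • x + x := by push_cast; module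
      rw [e, step, ih]
  induction n with
  | zero => simp
  | succ n ih =>
    have e : z + ((n + 1 : ℕ):ℝ) • x = z + (n:ℝ) • x + x := by push_cast; module
    have := step' n
    rw [sub_eq_iff_eq_add, ih] at this
    rw [e, this]
    push_cast; module

lemma pres_mul (hX : 2 ≤ Module.rank ℝ X) (hY : Module.finrank ℝ Y = 2)
    (hsc : ∀ a b : Y, a ≠ 0 → b ≠ 0 → ‖a + b‖ = ‖a‖ + ‖b‖ → ∃ γ : ℝ, 0 < γ ∧ a = γ • b)
    {ρ : ℝ} (hρ : 0 < ρ)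
    (f : X → Y) (hf : ∀ a b : X, ‖a - b‖ = ρ → ‖f a - f b‖ = ρ) (n : ℕ) (hn : 0 < n)
    (a b : X) (hab : ‖a - b‖ = n * ρ) : ‖f a - f b‖ = n * ρ := by
  have hn' : (0:ℝ) < n := by exact_mod_cast hn
  have hx : ‖(n:ℝ)⁻¹ • (a - b)‖ = ρ := by
    rw [norm_smul, hab, norm_inv, Real.norm_of_nonneg hn'.le]; field_simp
  have := line hX hY hsc hρ f hf b hx n
  rw [smul_inv_smul₀ hn'.ne', add_sub_cancel] at this
  rw [this, add_sub_cancel_left, norm_smul, Real.norm_of_nonneg hn'.le, hf]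
  rw [add_sub_cancel_left, hx]

lemma pres_div (hX : 2 ≤ Module.rank ℝ X) (hY : Module.finrank ℝ Y = 2)
    (hsc : ∀ a b : Y, a ≠ 0 → b ≠ 0 → ‖a + b‖ = ‖a‖ + ‖b‖ → ∃ γ : ℝ, 0 < γ ∧ a = γ • b)
    {ρ : ℝ} (hρ : 0 < ρ)
    (f : X → Y) (hf : ∀ a b : X, ‖a - b‖ = ρ → ‖f a - f b‖ = ρ) (n : ℕ) (hn : 0 < n)
    (a b : X) (hab : ‖a - b‖ = ρ / n) : ‖f a - f b‖ = ρ / n := by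
  have hn' : (1:ℝ) ≤ n := by exact_mod_cast hn
  have hn0 : (0:ℝ) < n := by linarith
  have hpos : 0 < ρ / n := by positivity
  have hle : ρ / n ≤ ρ := div_le_self hρ.le hn'
  have hne : a ≠ b := by
    rintro rfl
    rw [sub_self, norm_zero] at hab
    linarith
  obtain ⟨c, ha, hb⟩ := ivt hX a b ρ ρ hne hρ hρ (by simp) (by simp) (by linarith)
  rw [norm_sub_rev] at ha hb
  have la := line hX hY hsc hρ f hf c ha n
  have lb := line hX hY hsc hρ f hf c hb n
  rw [add_sub_cancel] at la lb
  have hd := hf (c + (n:ℝ) • (a - c)) (c + (n:ℝ) • (b - c)) (by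
    have e : c + (n:ℝ) • (a - c) - (c + (n:ℝ) • (b - c)) = (n:ℝ) • (a - b) := by module
    rw [e, norm_smul, Real.norm_of_nonneg hn0.le, hab]; field_simp)
  have e : f c + (n:ℝ) • (f a - f c) - (f c + (n:ℝ) • (f b - f c)) = (n:ℝ) • (f a - f b) := by
    module
  rw [la, lb, e, norm_smul, Real.norm_of_nonneg hn0.le] at hd
  rw [← hd]; field_simp

end Y

end BQ

/-- The Corollary: every map `f : X → Y` (not assumed injective) preserving the distance
`ρ` is an isometry, where `dim X ≥ dim Y = 2` and `Y` is strictly convex. -/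
theorem beckman_quarles_strictly_convex {X Y : Type*}
    [NormedAddCommGroup X] [NormedSpace ℝ X] [NormedAddCommGroup Y] [NormedSpace ℝ Y]
    (hX : 2 ≤ Module.rank ℝ X) (hY : Module.finrank ℝ Y = 2)
    (hsc : ∀ a b : Y, a ≠ 0 → b ≠ 0 → ‖a + b‖ = ‖a‖ + ‖b‖ → ∃ γ : ℝ, 0 < γ ∧ a = γ • b)
    (ρ : ℝ) (hρ : 0 < ρ) (f : X → Y)
    (hf : ∀ a b : X, ‖a - b‖ = ρ → ‖f a - f b‖ = ρ) :
    ∀ a b : X, ‖f a - f b‖ = ‖a - b‖ := by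
  intro a b
  by_cases hab : a = b
  · simp [hab]
  have hr : 0 < ‖a - b‖ := norm_pos_iff.2 (sub_ne_zero.2 hab)
  suffices h : |‖f a - f b‖ - ‖a - b‖| ≤ 0 by
    have := abs_nonpos_iff.1 h
    linarith
  apply le_of_forall_pos_le_add
  intro ε hε
  rw [zero_add]
  obtain ⟨n, hn⟩ := exists_nat_gt (ρ / min ‖a - b‖ (ε / 2))
  have hmin : 0 < min ‖a - b‖ (ε / 2) := lt_min hr (by linarith)
  have hn0 : (0:ℝ) < n := lt_trans (by positivity) hn
  have hn1 : 0 < n := by exact_mod_cast hn0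
  have hδ : 0 < ρ / n := by positivity
  have hδm : ρ / n < min ‖a - b‖ (ε / 2) := by
    rw [div_lt_iff₀ hmin] at hn
    rw [div_lt_iff₀ hn0]; linarith
  have hδ1 := lt_of_lt_of_le hδm (min_le_left _ _)
  have hδ2 := lt_of_lt_of_le hδm (min_le_right _ _)
  have hp := BQ.pres_div hX hY hsc hρ f hf n hn1
  set δ := ρ / n
  have hk1 := Nat.floor_le (div_nonneg hr.le hδ.le)
  have hk2 := Nat.lt_floor_add_one (‖a - b‖ / δ)
  have hk3 : 0 < ⌊‖a - b‖ / δ⌋₊ := Nat.floor_pos.2 ((one_le_div hδ).2 hδ1.le)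
  have hpk := BQ.pres_mul hX hY hsc hδ f hp _ hk3
  set k := ⌊‖a - b‖ / δ⌋₊
  rw [le_div_iff₀ hδ] at hk1
  rw [div_lt_iff₀ hδ] at hk2
  have hk0 : (0:ℝ) < k := by exact_mod_cast hk3
  obtain ⟨c, hc1, hc2⟩ := BQ.ivt hX a b (k * δ) δ hab (by positivity) hδ
    (by linarith) (by nlinarith) (by linarith)
  have q1 := hpk c a hc1
  have q2 := hp c b hc2
  have t1 := norm_sub_le_norm_sub_add_norm_sub (f a) (f c) (f b)
  have t2 := norm_sub_le_norm_sub_add_norm_sub (f a) (f b) (f c)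
  rw [norm_sub_rev (f a) (f c)] at t1 t2
  rw [norm_sub_rev (f b) (f c)] at t2
  rw [abs_le]
  constructor <;> linarith
end

section
/- Let X and Y be real normed spaces with dim X ≥ dim Y = 2, Y strictly convex, and ρ > 0. Then every injective map f : X → Y preserving the distance ρ is an isometry. -/
theorem bq_self_neg {Y : Type*} [NormedAddCommGroup Y] [NormedSpace ℝ Y] {x : Y} (h : x = -x) :
    x = 0 := by
  have h2 : (2 : ℝ) • x = 0 := by
    rw [two_smul]; nth_rewrite 2 [h]; exact add_neg_cancel x
  exact (smul_eq_zero.1 h2).resolve_left two_ne_zero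

theorem bq_aux_neg {Y : Type*} [NormedAddCommGroup Y] [NormedSpace ℝ Y] [StrictConvexSpace ℝ Y]
    {r s : ℝ} {c q p : Y} (hc : c ≠ 0) (hq1 : ‖q + c‖ = r) (hq2 : ‖q - c‖ = r)
    (hq : q = s • c + p) (k1 : ‖p + c‖ ≤ r) (hs : s < 0) : False := by
  have hne : q - c ≠ p + c := by
    intro h
    have : (s - 2) • c = 0 := by
      have h2 : q - c - (p + c) = 0 := sub_eq_zero.2 h
      rw [← h2, hq]; module
    rcases smul_eq_zero.1 this with h | h
    · linarith
    · exact hc h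
  have h2s : 0 < 2 - s := by linarith
  have hab : (-s) / (2 - s) + 2 / (2 - s) = 1 := by field_simp; ring
  have := norm_combo_lt_of_ne hq2.le k1 hne (a := (-s) / (2 - s)) (b := 2 / (2 - s))
    (div_pos (by linarith) h2s) (div_pos (by norm_num) h2s) hab
  rw [← hq1, hq] at this
  refine absurd this (not_lt.2 (le_of_eq ?_))
  congr 1
  match_scalars <;> field_simp <;> ring

theorem bq_aux_le {Y : Type*} [NormedAddCommGroup Y] [NormedSpace ℝ Y] [StrictConvexSpace ℝ Y]
    {r s t : ℝ} {c p q : Y} (hc : c ≠ 0) (hp : p ≠ 0)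
    (hp1 : ‖p + c‖ = r) (hp2 : ‖p - c‖ = r) (hq1 : ‖q + c‖ = r) (hq2 : ‖q - c‖ = r)
    (hq : q = s • c + t • p) (ht : |t| ≤ 1) : q = p ∨ q = -p := by
  have ht' := abs_le.1 ht
  have hcnv : ∀ x y : Y, ‖x‖ ≤ r → ‖y‖ ≤ r → ∀ a b : ℝ, 0 ≤ a → 0 ≤ b → a + b = 1 →
      ‖a • x + b • y‖ ≤ r := by
    intro x y hx hy a b ha hb hab
    calc ‖a • x + b • y‖ ≤ ‖a • x‖ + ‖b • y‖ := norm_add_le _ _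
      _ = a * ‖x‖ + b * ‖y‖ := by
        rw [norm_smul, norm_smul, Real.norm_of_nonneg ha, Real.norm_of_nonneg hb]
      _ ≤ a * r + b * r := by gcongr
      _ = r := by rw [← add_mul, hab, one_mul]
  have hp3 : ‖-p + c‖ = r := by rw [← hp2, ← norm_neg]; congr 1; abel
  have hp4 : ‖-p - c‖ = r := by rw [← hp1, ← norm_neg]; congr 1; abel
  have k1 : ‖t • p + c‖ ≤ r := by
    have := hcnv _ _ hp1.le hp3.le ((1 + t) / 2) ((1 - t) / 2) (by linarith) (by linarith) (by ring)
    convert this using 2; module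
  have k2 : ‖t • p - c‖ ≤ r := by
    have := hcnv _ _ hp2.le hp4.le ((1 + t) / 2) ((1 - t) / 2) (by linarith) (by linarith) (by ring)
    convert this using 2; module
  rcases lt_trichotomy s 0 with hs | hs | hs
  · exact (bq_aux_neg hc hq1 hq2 hq k1 hs).elim
  · subst hs
    rw [zero_smul, zero_add] at hq
    rcases eq_or_lt_of_le ht'.1 with h | h
    · right; rw [hq, ← h]; simp
    rcases eq_or_lt_of_le ht'.2 with h' | h'
    · left; rw [hq, h']; simp
    exfalso
    have hne : p + c ≠ -p + c := by
      intro h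
      have h2 : p = -p := add_right_cancel h
      exact hp (bq_self_neg h2)
    have := norm_combo_lt_of_ne hp1.le hp3.le hne (a := (1 + t) / 2) (b := (1 - t) / 2)
      (by linarith) (by linarith) (by ring)
    rw [← hq1, hq] at this
    refine absurd this (not_lt.2 (le_of_eq ?_))
    congr 1; module
  · refine (bq_aux_neg (c := -c) (s := -s) (p := t • p) (q := q) (r := r) (neg_ne_zero.2 hc)
      ?_ ?_ ?_ ?_ (by linarith)).elim
    · rw [← sub_eq_add_neg]; exact hq2
    · rw [sub_neg_eq_add]; exact hq1
    · rw [hq]; module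
    · rw [← sub_eq_add_neg]; exact k2

theorem bq_aux_zero {Y : Type*} [NormedAddCommGroup Y] [NormedSpace ℝ Y] [StrictConvexSpace ℝ Y]
    {r : ℝ} {c q : Y} (hc : ‖c‖ = r) (hq1 : ‖q + c‖ = r) (hq2 : ‖q - c‖ = r) : q = 0 := by
  by_contra hq
  have hq3 : ‖-q + c‖ = r := by rw [← hq2, ← norm_neg]; congr 1; abel
  have hne : q + c ≠ -q + c := fun h => hq (bq_self_neg (add_right_cancel h))
  have := norm_combo_lt_of_ne hq1.le hq3.le hne (a := 1 / 2) (b := 1 / 2)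
      (by norm_num) (by norm_num) (by norm_num)
  rw [← hc] at this
  refine absurd this (not_lt.2 (le_of_eq ?_))
  congr 1; module

theorem bq_two_points {Y : Type*} [NormedAddCommGroup Y] [NormedSpace ℝ Y] [StrictConvexSpace ℝ Y]
    (hY : Module.finrank ℝ Y = 2)
    {r : ℝ} {c p q : Y} (hc : c ≠ 0) (hpq : q ≠ p)
    (hp1 : ‖p + c‖ = r) (hp2 : ‖p - c‖ = r) (hq1 : ‖q + c‖ = r) (hq2 : ‖q - c‖ = r) :
    q = -p := by
  by_cases hp : p = 0
  · exfalso; subst hp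
    exact hpq (bq_aux_zero (by simpa using hp1) hq1 hq2)
  by_cases hq : q = 0
  · exfalso; subst hq
    exact hpq (bq_aux_zero (by simpa using hq1) hp1 hp2).symm
  have hli : LinearIndependent ℝ ![c, p] := by
    rw [LinearIndependent.pair_iff' hc]
    intro a ha
    have e1 : ‖p + c‖ = |a + 1| * ‖c‖ := by
      rw [← ha, ← Real.norm_eq_abs, ← norm_smul]; congr 1; module
    have e2 : ‖p - c‖ = |a - 1| * ‖c‖ := by
      rw [← ha, ← Real.norm_eq_abs, ← norm_smul]; congr 1; module
    have e3 : |a + 1| = |a - 1| := by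
      apply mul_right_cancel₀ (norm_ne_zero_iff.2 hc)
      rw [← e1, ← e2, hp1, hp2]
    have : a = 0 := by
      rcases abs_eq_abs.1 e3 with h | h <;> linarith
    exact hp (by rw [← ha, this, zero_smul])
  have : FiniteDimensional ℝ Y := FiniteDimensional.of_finrank_pos (by omega)
  have hspan := hli.span_eq_top_of_card_eq_finrank' (by simp [hY])
  have hmem : q ∈ Submodule.span ℝ (Set.range ![c, p]) := by rw [hspan]; trivial
  rw [Matrix.range_cons, Matrix.range_cons, Matrix.range_empty, Set.union_empty,
    Set.singleton_union, Submodule.mem_span_pair] at hmem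
  obtain ⟨s, t, hst⟩ := hmem
  by_cases ht : |t| ≤ 1
  · exact (bq_aux_le hc hp hp1 hp2 hq1 hq2 hst.symm ht).resolve_left hpq
  · push Not at ht
    have ht0 : t ≠ 0 := by rintro rfl; norm_num at ht
    have := bq_aux_le (s := -s / t) (t := 1 / t) hc hq hq1 hq2 hp1 hp2 ?_ ?_
    · rw [this.resolve_left hpq.symm, neg_neg]
    · rw [← hst]
      match_scalars <;> field_simp <;> ring
    · rw [abs_div, abs_one, div_le_one (by linarith)]; exact ht.le

theorem bq_parallelogram {Y : Type*} [NormedAddCommGroup Y] [NormedSpace ℝ Y]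
    [StrictConvexSpace ℝ Y] (hY : Module.finrank ℝ Y = 2)
    {r : ℝ} {a b p q : Y} (hab : a ≠ b) (hpq : q ≠ p)
    (hp1 : ‖p - a‖ = r) (hp2 : ‖p - b‖ = r) (hq1 : ‖q - a‖ = r) (hq2 : ‖q - b‖ = r) :
    p + q = a + b := by
  have := bq_two_points hY (r := r) (c := (1 / 2 : ℝ) • (b - a))
    (p := p - (1 / 2 : ℝ) • (a + b)) (q := q - (1 / 2 : ℝ) • (a + b))
    (by simpa [sub_eq_zero] using hab.symm) (by simpa using hpq)
    (by rw [← hp1]; congr 1; module) (by rw [← hp2]; congr 1; module)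
    (by rw [← hq1]; congr 1; module) (by rw [← hq2]; congr 1; module)
  rw [sub_eq_iff_eq_add] at this
  rw [this]; module

theorem bq_sum_two {X : Type*} [NormedAddCommGroup X] [NormedSpace ℝ X]
    (hX : 2 ≤ Module.rank ℝ X) {ρ : ℝ} (hρ : 0 < ρ) (w : X) (hw : ‖w‖ ≤ 2 * ρ) :
    ∃ u v : X, ‖u‖ = ρ ∧ ‖v‖ = ρ ∧ u + v = w := by
  have h1 : 1 < Module.rank ℝ X := lt_of_lt_of_le (by norm_num) hX
  have hpre := isPreconnected_sphere h1 (0 : X) ρ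
  have hex : ∃ e : X, ‖e‖ = ρ ∧ w = (‖w‖ / ρ) • e := by
    by_cases h0 : w = 0
    · subst h0
      have : Nontrivial X := by
        apply (rank_pos_iff_nontrivial (R := ℝ)).1
        exact lt_trans (by norm_num) h1
      obtain ⟨e, he⟩ := exists_norm_eq X hρ.le
      exact ⟨e, he, by simp⟩
    · have hn : ‖w‖ ≠ 0 := norm_ne_zero_iff.2 h0
      refine ⟨(ρ / ‖w‖) • w, ?_, ?_⟩
      · rw [norm_smul, Real.norm_of_nonneg (by positivity)]; field_simp
      · rw [smul_smul]
        have : ‖w‖ / ρ * (ρ / ‖w‖) = 1 := by field_simp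
        rw [this, one_smul]
  obtain ⟨e, he, hwe⟩ := hex
  have hf : ContinuousOn (fun u : X => ‖w - u‖) (Metric.sphere 0 ρ) := by fun_prop
  have hiv := hpre.intermediate_value (a := e) (b := -e) (by simpa using he) (by simpa using he) hf
  have hmem : ρ ∈ Set.Icc ‖w - e‖ ‖w - -e‖ := by
    have a1 : ‖w - e‖ = |‖w‖ / ρ - 1| * ρ := by
      nth_rewrite 2 [← he]
      rw [← Real.norm_eq_abs, ← norm_smul, sub_smul, ← hwe, one_smul]
    have a2 : ‖w - -e‖ = |‖w‖ / ρ + 1| * ρ := by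
      nth_rewrite 2 [← he]
      rw [← Real.norm_eq_abs, ← norm_smul, add_smul, ← hwe, one_smul, sub_neg_eq_add]
    have hd : ‖w‖ / ρ ≤ 2 := by rw [div_le_iff₀ hρ]; exact hw
    have hd0 : 0 ≤ ‖w‖ / ρ := by positivity
    rw [a1, a2]
    constructor
    · have : |‖w‖ / ρ - 1| ≤ 1 := abs_le.2 ⟨by linarith, by linarith⟩
      nlinarith
    · have : 1 ≤ |‖w‖ / ρ + 1| := le_trans (by linarith) (le_abs_self _)
      nlinarith
  obtain ⟨u, hu, huw⟩ := hiv hmem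
  exact ⟨u, w - u, by simpa using hu, huw, by abel⟩

theorem bq_subgroup_top {X : Type*} [NormedAddCommGroup X] [NormedSpace ℝ X]
    (hX : 2 ≤ Module.rank ℝ X) {ρ : ℝ} (hρ : 0 < ρ) (S : AddSubgroup X)
    (hS : ∀ u : X, ‖u‖ = ρ → u ∈ S) (w : X) : w ∈ S := by
  have hsmall : ∀ w : X, ‖w‖ ≤ 2 * ρ → w ∈ S := by
    intro w hw
    obtain ⟨u, v, hu, hv, rfl⟩ := bq_sum_two hX hρ w hw
    exact S.add_mem (hS u hu) (hS v hv)
  obtain ⟨n, hn⟩ := exists_nat_gt (‖w‖ / (2 * ρ))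
  have hn0 : (0 : ℝ) < n := lt_of_le_of_lt (by positivity) hn
  have hm : (1 / (n : ℝ)) • w ∈ S := by
    apply hsmall
    rw [norm_smul, Real.norm_of_nonneg (by positivity)]
    rw [div_lt_iff₀ (by positivity)] at hn
    rw [one_div, inv_mul_le_iff₀ hn0]
    exact hn.le
  have := S.nsmul_mem hm n
  rw [← Nat.cast_smul_eq_nsmul ℝ, smul_smul, mul_one_div_cancel hn0.ne', one_smul] at this
  exact this

/-- Every injective map `f : X → Y` preserving the distance `ρ` is an isometry, where
`dim X ≥ dim Y = 2` and `Y` is strictly convex. -/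
theorem beckman_quarles_strictly_convex_injective {X Y : Type*}
    [NormedAddCommGroup X] [NormedSpace ℝ X] [NormedAddCommGroup Y] [NormedSpace ℝ Y]
    (hX : 2 ≤ Module.rank ℝ X) (hY : Module.finrank ℝ Y = 2)
    (hsc : ∀ a b : Y, a ≠ 0 → b ≠ 0 → ‖a + b‖ = ‖a‖ + ‖b‖ → ∃ γ : ℝ, 0 < γ ∧ a = γ • b)
    (ρ : ℝ) (hρ : 0 < ρ) (f : X → Y) (hinj : Function.Injective f)
    (hf : ∀ a b : X, ‖a - b‖ = ρ → ‖f a - f b‖ = ρ) :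
    ∀ a b : X, ‖f a - f b‖ = ‖a - b‖ := by
  have : StrictConvexSpace ℝ Y := by
    refine StrictConvexSpace.of_norm_add fun x y hx hy hxy => ?_
    have hx0 : x ≠ 0 := by rintro rfl; simp at hx
    have hy0 : y ≠ 0 := by rintro rfl; simp at hy
    obtain ⟨γ, hγ, rfl⟩ := hsc x y hx0 hy0 (by rw [hx, hy, hxy]; norm_num)
    exact SameRay.sameRay_pos_smul_left y hγ
  -- parallelograms with distinct directions
  have hpar : ∀ x u v : X, ‖u‖ = ρ → ‖v‖ = ρ → u ≠ v → u ≠ -v →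
      f x + f (x + u + v) = f (x + u) + f (x + v) := by
    intro x u v hu hv huv huv'
    refine bq_parallelogram hY (r := ρ) ?_ ?_ ?_ ?_ ?_ ?_
    · intro h; exact huv (add_left_cancel (hinj h))
    · intro h
      have h1 := hinj h
      rw [add_assoc, add_eq_left] at h1
      exact huv' (eq_neg_of_add_eq_zero_left h1)
    · apply hf; rw [← hu, ← norm_neg]; congr 1; abel
    · apply hf; rw [← hv, ← norm_neg]; congr 1; abel
    · apply hf; rw [← hv]; congr 1; abel
    · apply hf; rw [← hu]; congr 1; abel
  have hconst : ∀ u : X, ‖u‖ = ρ → ∀ w x : X, f (x + w + u) - f (x + w) = f (x + u) - f x := by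
    intro u hu
    let S : AddSubgroup X :=
      { carrier := {w | ∀ x : X, f (x + w + u) - f (x + w) = f (x + u) - f x}
        zero_mem' := by intro x; simp
        add_mem' := by
          intro a b ha hb x
          rw [← add_assoc, hb (x + a), ha x]
        neg_mem' := by
          intro a ha x
          have := ha (x + -a)
          rw [neg_add_cancel_right] at this
          exact this.symm }
    have hS1 : ∀ v : X, ‖v‖ = ρ → u ≠ v → u ≠ -v → v ∈ S := by
      intro v hv h1 h2 x
      have := hpar x u v hu hv h1 h2
      have e : x + v + u = x + u + v := by abel
      rw [e, sub_eq_sub_iff_add_eq_add, add_comm, this]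
    have hu0 : u ≠ 0 := by rintro rfl; simp at hu; linarith
    have hS2 : u ∈ S := by
      obtain ⟨v, w, hv, hw, hvw⟩ := bq_sum_two hX hρ u (by linarith)
      have key : ∀ v w : X, ‖v‖ = ρ → ‖w‖ = ρ → v + w = u → v ∈ S := by
        intro v w hv hw hvw
        refine hS1 v hv ?_ ?_
        · rintro rfl
          rw [add_eq_left] at hvw
          subst hvw; simp at hw; linarith
        · intro h
          have : w = (2 : ℝ) • u := by
            have h3 : v = -u := by rw [h, neg_neg]
            rw [h3] at hvw
            rw [two_smul]; nth_rewrite 1 [← hvw]; abel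
          rw [this, norm_smul, hu] at hw
          norm_num at hw; linarith
      rw [← hvw]
      exact S.add_mem (key v w hv hw hvw) (key w v hw hv (by rw [add_comm, hvw]))
    have hS : ∀ v : X, ‖v‖ = ρ → v ∈ S := by
      intro v hv
      by_cases h1 : u = v
      · exact h1 ▸ hS2
      by_cases h2 : u = -v
      · have : v = -u := by rw [h2, neg_neg]
        rw [this]; exact S.neg_mem hS2
      exact hS1 v hv h1 h2
    intro w
    exact bq_subgroup_top hX hρ S hS w
  have hadd : ∀ w x : X, f (x + w) - f x = f w - f 0 := by
    let S : AddSubgroup X :=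
      { carrier := {w | ∀ x y : X, f (x + w) - f x = f (y + w) - f y}
        zero_mem' := by intro x; simp
        add_mem' := by
          intro a b ha hb x y
          have h1 := ha x y
          have h2 := hb (x + a) (y + a)
          rw [← add_assoc, ← add_assoc]
          have := congrArg₂ (· + ·) h1 h2
          simpa using this
        neg_mem' := by
          intro a ha x y
          have := ha (x + -a) (y + -a)
          rw [neg_add_cancel_right, neg_add_cancel_right] at this
          rw [← neg_sub, this, neg_sub] }
    intro w x
    have := bq_subgroup_top hX hρ S (fun u hu x y => by
      have h1 := hconst u hu (y - x) x
      rw [add_sub_cancel] at h1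
      exact h1.symm) w x 0
    simpa using this
  let F : X →+ Y := AddMonoidHom.mk' (fun x => f x - f 0) (by
    intro a b
    have := hadd b a
    rw [← this]; abel)
  have hFu : ∀ u : X, ‖u‖ = ρ → ‖F u‖ = ρ := fun u hu => hf u 0 (by simpa using hu)
  have hFc : Continuous F := by
    refine F.continuous_of_isBounded_nhds_zero (Metric.closedBall_mem_nhds (0 : X) hρ) ?_
    rw [isBounded_iff_forall_norm_le]
    refine ⟨2 * ρ, ?_⟩
    rintro _ ⟨w, hw, rfl⟩
    rw [mem_closedBall_zero_iff] at hw
    obtain ⟨u, v, hu, hv, rfl⟩ := bq_sum_two hX hρ w (by linarith)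
    rw [map_add]
    refine (norm_add_le _ _).trans ?_
    rw [hFu u hu, hFu v hv]; linarith
  have hFn : ∀ w : X, ‖F w‖ = ‖w‖ := by
    intro w
    by_cases h0 : w = 0
    · subst h0; simp
    have hn : ‖w‖ ≠ 0 := norm_ne_zero_iff.2 h0
    have h1 := hFu ((ρ / ‖w‖) • w) (by
      rw [norm_smul, Real.norm_of_nonneg (by positivity)]; field_simp)
    rw [map_real_smul F hFc, norm_smul, Real.norm_of_nonneg (by positivity)] at h1
    field_simp at h1
    exact h1
  intro a b
  rw [← hFn (a - b), map_sub]
  change _ = ‖(f a - f 0) - (f b - f 0)‖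
  rw [sub_sub_sub_cancel_right]
end
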